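/- In dimensions d ≥ 3, the fourth-order extremal values satisfy U_4 = 2 and L_4 = −2. That is: for every n, every S ⊆ W_n with |S| = 4, and every ω ∈ Ω_n one has −2(b−a) ≤ ∂_S f_n(ω) ≤ 2(b−a); moreover there exist n, S with |S| = 4, and ω with ∂_S f_n(ω) = 2(b−a), and there exist n, S with |S| = 4, and ω with ∂_S f_n(ω) = −2(b−a). -/

import Mathlib

noncomputable section

/-! ### First-passage percolation model

Vertices are points of `ℤ^d`; two vertices are adjacent when their ℓ¹-distance is `1`.
For `n : ℕ`, the graph is restricted to the box `[-2n, 2n]^d`; `EdgeSet d n` is its edge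
set `W_n`, and an environment `ω ∈ Ω_n = {a,b}^{W_n}` is modelled as a function
`Sym2 (Vtx d) → ℝ` whose values on `W_n` lie in `{a, b}` (`ValidEnv`).  `fppT d v n ω`
is the minimal passage time from the source `0` to the sink `n • v`. -/

abbrev Vtx (d : ℕ) : Type := Fin d → ℤ

/-- Two lattice points are adjacent when their ℓ¹ distance equals 1. -/
def adjV {d : ℕ} (x y : Vtx d) : Prop := (∑ i, |x i - y i|) = 1

/-- A vertex lies in the box `[-2n, 2n]^d`. -/
def inBox {d : ℕ} (n : ℕ) (x : Vtx d) : Prop := ∀ i, |x i| ≤ (2 * n : ℤ)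

/-- The edge set `W_n`: nearest-neighbour pairs inside the box. -/
def EdgeSet (d n : ℕ) : Set (Sym2 (Vtx d)) :=
  {e | ∃ x y : Vtx d, e = s(x, y) ∧ adjV x y ∧ inBox n x ∧ inBox n y}

/-- `p` is a path from `u` to `w` inside the box `[-2n, 2n]^d`. -/
def IsPath {d : ℕ} (n : ℕ) (u w : Vtx d) (p : List (Vtx d)) : Prop :=
  p.Chain' adjV ∧ p.head? = some u ∧ p.getLast? = some w ∧ ∀ x ∈ p, inBox n x

/-- The passage time `T(p, ω)`: the sum of `ω_e` over the edges of `p`. -/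
def pathTime {d : ℕ} (ω : Sym2 (Vtx d) → ℝ) (p : List (Vtx d)) : ℝ :=
  ((p.zip p.tail).map fun q => ω s(q.1, q.2)).sum

/-- The first-passage time `f_n(ω)`: minimal passage time from `0` to `n • v`. -/
def fppT (d : ℕ) (v : Vtx d) (n : ℕ) (ω : Sym2 (Vtx d) → ℝ) : ℝ :=
  sInf {t : ℝ | ∃ p : List (Vtx d), IsPath n 0 (fun i => (n : ℤ) * v i) p ∧ t = pathTime ω p}

/-- A geodesic: a path from `0` to `n • v` attaining the minimal passage time. -/
def IsGeodesic (d : ℕ) (v : Vtx d) (n : ℕ) (ω : Sym2 (Vtx d) → ℝ) (p : List (Vtx d)) : Prop :=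
  IsPath n 0 (fun i => (n : ℤ) * v i) p ∧ pathTime ω p = fppT d v n ω

/-- The list of edges traversed by a path. -/
def edgesOf {d : ℕ} (p : List (Vtx d)) : List (Sym2 (Vtx d)) :=
  (p.zip p.tail).map fun q => s(q.1, q.2)

/-- First-order environment derivative `∂_j φ = φ∘σ_j^b − φ∘σ_j^a`, where `σ_j^δ` sets
coordinate `j` to `δ`. -/
def envDeriv {E : Type*} [DecidableEq E] (a b : ℝ) (j : E) (φ : (E → ℝ) → ℝ) : (E → ℝ) → ℝ :=
  fun ω => φ (Function.update ω j b) - φ (Function.update ω j a)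

/-- Higher-order environment derivative `∂_S φ`, obtained by iterating the first-order
derivative over the elements of `S` (the recursion `∂_S φ = ∂_{S∖{j}}(∂_j φ)`; the result
is independent of the order). -/
def envDerivOn {E : Type*} [DecidableEq E] (a b : ℝ) (S : Finset E) (φ : (E → ℝ) → ℝ) :
    (E → ℝ) → ℝ :=
  S.toList.foldr (fun j ψ => envDeriv a b j ψ) φ

/-- `ω ∈ Ω_n = {a,b}^{W_n}`: the environment takes only the values `a`, `b` on `W_n`. -/
def ValidEnv (d n : ℕ) (a b : ℝ) (ω : Sym2 (Vtx d) → ℝ) : Prop :=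
  ∀ e ∈ EdgeSet d n, ω e = a ∨ ω e = b


/-! ### Abstract part: third order derivative bound -/

section AbstractPart

variable {E : Type*} [DecidableEq E]

/-- Abstract first passage system: `f` is a minimum over edge lists in `P`, with exchange. -/
structure FppSys (f : (E → ℝ) → ℝ) (P : Set (List E)) (V : (E → ℝ) → Prop) : Prop where
  le : ∀ ω, V ω → ∀ l ∈ P, f ω ≤ (l.map ω).sum
  ex : ∀ ω, V ω → ∃ l ∈ P, l.Nodup ∧ (l.map ω).sum = f ω
  exch : ∀ ω, V ω → ∀ p1 e p2 q1 q2, p1 ++ e :: p2 ∈ P → q1 ++ e :: q2 ∈ P →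
    f ω ≤ (p1.map ω).sum + ω e + (q2.map ω).sum

/-- Environment with three coordinates replaced. -/
def env3 (ω : E → ℝ) (e1 : E) (x : ℝ) (e2 : E) (y : ℝ) (e3 : E) (z : ℝ) : E → ℝ :=
  fun e => if e = e1 then x else if e = e2 then y else if e = e3 then z else ω e

lemma env3_swap12 (ω : E → ℝ) {e1 e2 e3 : E} (h12 : e1 ≠ e2) (x y z : ℝ) :
    env3 ω e2 y e1 x e3 z = env3 ω e1 x e2 y e3 z := by
  funext e
  unfold env3
  by_cases h1 : e = e1
  · subst h1; simp [h12]
  · simp [h1]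

lemma env3_swap23 (ω : E → ℝ) {e1 e2 e3 : E} (h23 : e2 ≠ e3) (x y z : ℝ) :
    env3 ω e1 x e3 z e2 y = env3 ω e1 x e2 y e3 z := by
  funext e
  unfold env3
  by_cases h1 : e = e2
  · subst h1; simp [h23]
  · simp [h1]

lemma env3_sum (ω : E → ℝ) {e1 e2 e3 : E} (h12 : e1 ≠ e2) (h13 : e1 ≠ e3) (h23 : e2 ≠ e3)
    (x y z : ℝ) (l : List E) :
    (l.map (env3 ω e1 x e2 y e3 z)).sum =
      (l.map (env3 ω e1 0 e2 0 e3 0)).sum + x * (l.count e1 : ℝ) + y * (l.count e2 : ℝ)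
        + z * (l.count e3 : ℝ) := by
  induction l with
  | nil => simp
  | cons c l ih =>
    simp only [List.map_cons, List.sum_cons, ih]
    by_cases h1 : c = e1
    · subst h1
      rw [List.count_cons_self, List.count_cons_of_ne h12, List.count_cons_of_ne h13]
      simp [env3]; ring
    · by_cases h2 : c = e2
      · subst h2
        rw [List.count_cons_self, List.count_cons_of_ne (Ne.symm h12), List.count_cons_of_ne h23]
        simp [env3, h1]; ring
      · by_cases h3 : c = e3
        · subst h3
          rw [List.count_cons_self, List.count_cons_of_ne (Ne.symm h13),
            List.count_cons_of_ne (Ne.symm h23)]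
          simp [env3, h1, h2]; ring
        · rw [List.count_cons_of_ne h1, List.count_cons_of_ne h2, List.count_cons_of_ne h3]
          simp [env3, h1, h2, h3]; ring

variable {f : (E → ℝ) → ℝ} {P : Set (List E)} {V : (E → ℝ) → Prop}

lemma FppSys.lip_aux (l : List E) (hl : l.Nodup) (ω ω' : E → ℝ) (e1 : E) (c : ℝ) (hc : 0 ≤ c)
    (h : ∀ e, e ≠ e1 → ω' e ≤ ω e) (h1 : ω' e1 ≤ ω e1 + c) :
    (l.map ω').sum ≤ (l.map ω).sum + c ∧ (e1 ∉ l → (l.map ω').sum ≤ (l.map ω).sum) := by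
  induction l with
  | nil => simp [hc]
  | cons d l ih =>
    rw [List.nodup_cons] at hl
    obtain ⟨ih1, ih2⟩ := ih hl.2
    simp only [List.map_cons, List.sum_cons, List.mem_cons, not_or]
    by_cases hd : d = e1
    · subst hd
      have := ih2 hl.1
      refine ⟨by linarith, fun hh => absurd rfl hh.1⟩
    · have := h d hd
      exact ⟨by linarith, fun hh => by have := ih2 hh.2; linarith⟩

lemma FppSys.lip (hs : FppSys f P V) {ω ω' : E → ℝ} (hω : V ω) (hω' : V ω') (e1 : E) {c : ℝ}
    (hc : 0 ≤ c) (h : ∀ e, e ≠ e1 → ω' e ≤ ω e) (h1 : ω' e1 ≤ ω e1 + c) : f ω' ≤ f ω + c := by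
  obtain ⟨l, hl, hn, he⟩ := hs.ex ω hω
  have := (FppSys.lip_aux l hn ω ω' e1 c hc h h1).1
  have := hs.le ω' hω' l hl
  linarith

lemma FppSys.mono (hs : FppSys f P V) {ω ω' : E → ℝ} (hω : V ω) (hω' : V ω')
    (h : ∀ e, ω e ≤ ω' e) : f ω ≤ f ω' := by
  obtain ⟨l, hl, hn, he⟩ := hs.ex ω' hω'
  have h1 := hs.le ω hω l hl
  have : (l.map ω).sum ≤ (l.map ω').sum := List.sum_le_sum (fun i _ => h i)
  linarith

/-- all corner environments are valid -/
def Valid3 (V : (E → ℝ) → Prop) (a b : ℝ) (ω : E → ℝ) (e1 e2 e3 : E) : Prop :=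
  ∀ x y z, (x = a ∨ x = b) → (y = a ∨ y = b) → (z = a ∨ z = b) → V (env3 ω e1 x e2 y e3 z)

lemma Valid3.swap12 {a b : ℝ} {ω : E → ℝ} {e1 e2 e3 : E} (h12 : e1 ≠ e2)
    (h : Valid3 V a b ω e1 e2 e3) : Valid3 V a b ω e2 e1 e3 := by
  intro x y z hx hy hz
  rw [env3_swap12 ω h12]
  exact h y x z hy hx hz

lemma Valid3.swap23 {a b : ℝ} {ω : E → ℝ} {e1 e2 e3 : E} (h23 : e2 ≠ e3)
    (h : Valid3 V a b ω e1 e2 e3) : Valid3 V a b ω e1 e3 e2 := by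
  intro x y z hx hy hz
  rw [env3_swap23 ω h23]
  exact h x z y hx hz hy

section three

variable (f) in
/-- upper inequality -/
def UpIneq (a b : ℝ) (ω : E → ℝ) (e1 e2 e3 : E) : Prop :=
  f (env3 ω e1 b e2 b e3 b) + f (env3 ω e1 b e2 a e3 a) + f (env3 ω e1 a e2 b e3 a)
    + f (env3 ω e1 a e2 a e3 b) ≤
  f (env3 ω e1 b e2 b e3 a) + f (env3 ω e1 b e2 a e3 b) + f (env3 ω e1 a e2 b e3 b)
    + f (env3 ω e1 a e2 a e3 a) + (b - a)

variable (f) in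
/-- lower inequality -/
def LowIneq (a b : ℝ) (ω : E → ℝ) (e1 e2 e3 : E) : Prop :=
  f (env3 ω e1 b e2 b e3 a) + f (env3 ω e1 b e2 a e3 b) + f (env3 ω e1 a e2 b e3 b)
    + f (env3 ω e1 a e2 a e3 a) ≤
  f (env3 ω e1 b e2 b e3 b) + f (env3 ω e1 b e2 a e3 a) + f (env3 ω e1 a e2 b e3 a)
    + f (env3 ω e1 a e2 a e3 b) + (b - a)

lemma UpIneq.swap12 {a b : ℝ} {ω : E → ℝ} {e1 e2 e3 : E} (h12 : e1 ≠ e2)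
    (h : UpIneq f a b ω e2 e1 e3) : UpIneq f a b ω e1 e2 e3 := by
  unfold UpIneq at *
  simp only [env3_swap12 ω h12] at h
  linarith

lemma UpIneq.swap23 {a b : ℝ} {ω : E → ℝ} {e1 e2 e3 : E} (h23 : e2 ≠ e3)
    (h : UpIneq f a b ω e1 e3 e2) : UpIneq f a b ω e1 e2 e3 := by
  unfold UpIneq at *
  simp only [env3_swap23 ω h23] at h
  linarith

lemma LowIneq.swap12 {a b : ℝ} {ω : E → ℝ} {e1 e2 e3 : E} (h12 : e1 ≠ e2)
    (h : LowIneq f a b ω e2 e1 e3) : LowIneq f a b ω e1 e2 e3 := by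
  unfold LowIneq at *
  simp only [env3_swap12 ω h12] at h
  linarith

lemma LowIneq.swap23 {a b : ℝ} {ω : E → ℝ} {e1 e2 e3 : E} (h23 : e2 ≠ e3)
    (h : LowIneq f a b ω e1 e3 e2) : LowIneq f a b ω e1 e2 e3 := by
  unfold LowIneq at *
  simp only [env3_swap23 ω h23] at h
  linarith

/-- Simple comparison: all eight values, in one place. -/
lemma FppSys.cube (hs : FppSys f P V) {a b : ℝ} (hab : a < b) {ω : E → ℝ} {e1 e2 e3 : E}
    (hv : Valid3 V a b ω e1 e2 e3)
    {x y z x' y' z' : ℝ} (hx : x = a ∨ x = b) (hy : y = a ∨ y = b) (hz : z = a ∨ z = b)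
    (hx' : x' = a ∨ x' = b) (hy' : y' = a ∨ y' = b) (hz' : z' = a ∨ z' = b)
    (h1 : x ≤ x') (h2 : y ≤ y') (h3 : z ≤ z') :
    f (env3 ω e1 x e2 y e3 z) ≤ f (env3 ω e1 x' e2 y' e3 z') := by
  refine hs.mono (hv _ _ _ hx hy hz) (hv _ _ _ hx' hy' hz') (fun e => ?_)
  unfold env3
  split_ifs <;> first | assumption | exact le_rfl

lemma FppSys.lip1 (hs : FppSys f P V) {a b : ℝ} (hab : a < b) {ω : E → ℝ} {e1 e2 e3 : E}
    (hv : Valid3 V a b ω e1 e2 e3)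
    {y z : ℝ} (hy : y = a ∨ y = b) (hz : z = a ∨ z = b) :
    f (env3 ω e1 b e2 y e3 z) ≤ f (env3 ω e1 a e2 y e3 z) + (b - a) := by
  refine hs.lip (hv _ _ _ (.inl rfl) hy hz) (hv _ _ _ (.inr rfl) hy hz) e1 (by linarith) ?_ ?_
  · intro e he; simp [env3, he]
  · simp [env3]

lemma FppSys.lip2 (hs : FppSys f P V) {a b : ℝ} (hab : a < b) {ω : E → ℝ} {e1 e2 e3 : E}
    (h12 : e1 ≠ e2) (hv : Valid3 V a b ω e1 e2 e3)
    {y z : ℝ} (hy : y = a ∨ y = b) (hz : z = a ∨ z = b) :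
    f (env3 ω e1 y e2 b e3 z) ≤ f (env3 ω e1 y e2 a e3 z) + (b - a) := by
  have := hs.lip1 hab (hv.swap12 h12) hy hz
  simpa only [env3_swap12 ω h12] using this

lemma FppSys.lip3 (hs : FppSys f P V) {a b : ℝ} (hab : a < b) {ω : E → ℝ} {e1 e2 e3 : E}
    (h12 : e1 ≠ e2) (h13 : e1 ≠ e3) (h23 : e2 ≠ e3) (hv : Valid3 V a b ω e1 e2 e3)
    {y z : ℝ} (hy : y = a ∨ y = b) (hz : z = a ∨ z = b) :
    f (env3 ω e1 y e2 z e3 b) ≤ f (env3 ω e1 y e2 z e3 a) + (b - a) := by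
  have := hs.lip2 hab h13 (hv.swap23 h23) hy hz
  simpa only [env3_swap23 ω h23] using this

variable {a b : ℝ} {ω : E → ℝ} {e1 e2 e3 : E}

/-- upper inequality if the `aaa` geodesic misses `e1` -/
lemma FppSys.up_miss1 (hs : FppSys f P V) (hab : a < b) (h12 : e1 ≠ e2) (h13 : e1 ≠ e3)
    (h23 : e2 ≠ e3) (hv : Valid3 V a b ω e1 e2 e3)
    (l : List E) (hl : l ∈ P) (hg : (l.map (env3 ω e1 a e2 a e3 a)).sum = f (env3 ω e1 a e2 a e3 a))
    (hm : e1 ∉ l) : UpIneq f a b ω e1 e2 e3 := by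
  have k1 := hs.le _ (hv b a a (.inr rfl) (.inl rfl) (.inl rfl)) l hl
  rw [env3_sum ω h12 h13 h23] at k1 hg
  rw [List.count_eq_zero_of_not_mem hm] at k1 hg
  have k2 := hs.lip1 hab hv (y := b) (z := b) (.inr rfl) (.inr rfl)
  have k3 := hs.cube hab hv (x := a) (y := b) (z := a) (x' := b) (y' := b) (z' := a)
    (by simp) (by simp) (by simp) (by simp) (by simp) (by simp) hab.le le_rfl le_rfl
  have k4 := hs.cube hab hv (x := a) (y := a) (z := b) (x' := b) (y' := a) (z' := b)
    (by simp) (by simp) (by simp) (by simp) (by simp) (by simp) hab.le le_rfl le_rfl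
  unfold UpIneq
  push_cast at k1 hg
  linarith

/-- upper inequality if `e2` is the middle edge -/
lemma FppSys.up_mid (hs : FppSys f P V) (hab : a < b) (h12 : e1 ≠ e2) (h13 : e1 ≠ e3)
    (h23 : e2 ≠ e3) (hv : Valid3 V a b ω e1 e2 e3)
    (p1 p2 : List E) (hl : p1 ++ e2 :: p2 ∈ P) (hn : (p1 ++ e2 :: p2).Nodup)
    (hg : ((p1 ++ e2 :: p2).map (env3 ω e1 a e2 a e3 a)).sum = f (env3 ω e1 a e2 a e3 a))
    (hm1 : e1 ∈ p1) (hm3 : e3 ∈ p2) : UpIneq f a b ω e1 e2 e3 := by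
  obtain ⟨q, hq, hqn, hqg⟩ := hs.ex _ (hv b a b (.inr rfl) (.inl rfl) (.inr rfl))
  by_cases h2 : e2 ∈ q
  · obtain ⟨q1, q2, rfl⟩ := List.append_of_mem h2
    have x1 := hs.exch _ (hv a a b (.inl rfl) (.inl rfl) (.inr rfl)) p1 e2 p2 q1 q2 hl hq
    have x2 := hs.exch _ (hv b a a (.inr rfl) (.inl rfl) (.inl rfl)) q1 e2 q2 p1 p2 hq hl
    have c1 := List.nodup_iff_count_le_one.1 hn e1
    have c2 := List.nodup_iff_count_le_one.1 hn e2
    have c3 := List.nodup_iff_count_le_one.1 hn e3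
    have m1 := List.count_pos_iff.2 hm1
    have m3 := List.count_pos_iff.2 hm3
    have E2 : env3 ω e1 a e2 a e3 b e2 = a := by simp [env3, h12.symm]
    have E2' : env3 ω e1 b e2 a e3 a e2 = a := by simp [env3, h12.symm]
    have E2'' : env3 ω e1 a e2 a e3 a e2 = a := by simp [env3, h12.symm]
    have E2''' : env3 ω e1 b e2 a e3 b e2 = a := by simp [env3, h12.symm]
    simp only [List.map_append, List.map_cons, List.sum_append, List.sum_cons, E2, E2', E2'', E2''']
      at x1 x2 hg hqg
    simp only [List.count_append, List.count_cons_self, List.count_cons_of_ne h12.symm,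
      List.count_cons_of_ne h23] at c1 c2 c3
    rw [env3_sum ω h12 h13 h23 a a b] at x1
    rw [env3_sum ω h12 h13 h23 a a b q2] at x1
    rw [env3_sum ω h12 h13 h23 b a a] at x2
    rw [env3_sum ω h12 h13 h23 b a a p2] at x2
    rw [env3_sum ω h12 h13 h23 a a a] at hg
    rw [env3_sum ω h12 h13 h23 a a a p2] at hg
    rw [env3_sum ω h12 h13 h23 b a b] at hqg
    rw [env3_sum ω h12 h13 h23 b a b q2] at hqg
    have z1 : p1.count e3 = 0 := by omega
    have z2 : p2.count e1 = 0 := by omega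
    rw [z1] at x1 hg
    rw [z2] at x2 hg
    have n1 : 0 ≤ (b - a) * (q1.count e3 : ℝ) := mul_nonneg (by linarith) (Nat.cast_nonneg _)
    have n2 : 0 ≤ (b - a) * (q2.count e1 : ℝ) := mul_nonneg (by linarith) (Nat.cast_nonneg _)
    have k2 := hs.lip3 hab h12 h13 h23 hv (y := b) (z := b) (.inr rfl) (.inr rfl)
    have k3 := hs.cube hab hv (x := a) (y := b) (z := a) (x' := a) (y' := b) (z' := b)
      (by simp) (by simp) (by simp) (by simp) (by simp) (by simp) le_rfl le_rfl hab.le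
    unfold UpIneq
    push_cast at *
    linarith
  · have k1 := hs.le _ (hv b b b (.inr rfl) (.inr rfl) (.inr rfl)) q hq
    rw [env3_sum ω h12 h13 h23] at k1 hqg
    rw [List.count_eq_zero_of_not_mem h2] at k1 hqg
    have k2 := hs.lip2 hab h12 hv (y := a) (z := a) (.inl rfl) (.inl rfl)
    have k3 := hs.cube hab hv (x := b) (y := a) (z := a) (x' := b) (y' := b) (z' := a)
      (by simp) (by simp) (by simp) (by simp) (by simp) (by simp) le_rfl hab.le le_rfl
    have k4 := hs.cube hab hv (x := a) (y := a) (z := b) (x' := a) (y' := b) (z' := b)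
      (by simp) (by simp) (by simp) (by simp) (by simp) (by simp) le_rfl hab.le le_rfl
    unfold UpIneq
    push_cast at *
    linarith

lemma FppSys.up (hs : FppSys f P V) (hab : a < b) (h12 : e1 ≠ e2) (h13 : e1 ≠ e3)
    (h23 : e2 ≠ e3) (hv : Valid3 V a b ω e1 e2 e3) : UpIneq f a b ω e1 e2 e3 := by
  obtain ⟨l, hl, hn, hg⟩ := hs.ex _ (hv a a a (.inl rfl) (.inl rfl) (.inl rfl))
  have v213 := hv.swap12 h12
  have v132 := hv.swap23 h23
  have v231 := v213.swap23 h13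
  have v312 := v132.swap12 h13
  have v321 := v231.swap12 h23
  have g213 : (l.map (env3 ω e2 a e1 a e3 a)).sum = f (env3 ω e2 a e1 a e3 a) := by
    rw [env3_swap12 ω h12]; exact hg
  have g132 : (l.map (env3 ω e1 a e3 a e2 a)).sum = f (env3 ω e1 a e3 a e2 a) := by
    rw [env3_swap23 ω h23]; exact hg
  have g231 : (l.map (env3 ω e2 a e3 a e1 a)).sum = f (env3 ω e2 a e3 a e1 a) := by
    rw [env3_swap23 ω h13]; exact g213
  have g312 : (l.map (env3 ω e3 a e1 a e2 a)).sum = f (env3 ω e3 a e1 a e2 a) := by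
    rw [env3_swap12 ω h13]; exact g132
  have g321 : (l.map (env3 ω e3 a e2 a e1 a)).sum = f (env3 ω e3 a e2 a e1 a) := by
    rw [env3_swap12 ω h23]; exact g231
  by_cases m1 : e1 ∈ l
  swap
  · exact hs.up_miss1 hab h12 h13 h23 hv l hl hg m1
  by_cases m2 : e2 ∈ l
  swap
  · exact (hs.up_miss1 hab h12.symm h23 h13 v213 l hl g213 m2).swap12 h12
  by_cases m3 : e3 ∈ l
  swap
  · exact ((hs.up_miss1 hab h13.symm h23.symm h12 v312 l hl g312 m3).swap12 h13).swap23 h23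
  obtain ⟨p1, p2, rfl⟩ := List.append_of_mem m2
  have m1' : e1 ∈ p1 ∨ e1 ∈ p2 := by simpa [h12] using m1
  have m3' : e3 ∈ p1 ∨ e3 ∈ p2 := by simpa [h23.symm] using m3
  rcases m1' with m1' | m1' <;> rcases m3' with m3' | m3'
  · obtain ⟨r, s, rfl⟩ := List.append_of_mem m1'
    have m3'' : e3 ∈ r ∨ e3 ∈ s := by simpa [h13.symm] using m3'
    simp only [List.append_assoc, List.cons_append] at *
    rcases m3'' with m | m
    · -- order 3 1 2
      exact ((hs.up_mid hab h13.symm h23.symm h12 v312 r (s ++ e2 :: p2) hl hn g312 m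
        (by simp)).swap12 h13).swap23 h23
    · -- order 1 3 2
      obtain ⟨s1, s2, rfl⟩ := List.append_of_mem m
      have := (hs.up_mid hab h13 h12 h23.symm v132 (r ++ e1 :: s1) (s2 ++ e2 :: p2)
        (by simpa using hl) (by simpa using hn) (by simpa using g132) (by simp)
        (by simp))
      exact this.swap23 h23
  · exact hs.up_mid hab h12 h13 h23 hv p1 p2 hl hn hg m1' m3'
  · exact (((hs.up_mid hab h23.symm h13.symm h12.symm v321 p1 p2 hl hn g321 m3'
      m1').swap12 h23).swap23 h13).swap12 h12
  · obtain ⟨r, s, rfl⟩ := List.append_of_mem m1'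
    have m3'' : e3 ∈ r ∨ e3 ∈ s := by simpa [h13.symm] using m3'
    rcases m3'' with m | m
    · -- order 2 3 1
      obtain ⟨s1, s2, rfl⟩ := List.append_of_mem m
      have := (hs.up_mid hab h23 h12.symm h13.symm v231 (p1 ++ e2 :: s1) (s2 ++ e1 :: s)
        (by simpa using hl) (by simpa using hn) (by simpa using g231) (by simp)
        (by simp))
      exact (this.swap23 h13).swap12 h12
    · -- order 2 1 3
      have := (hs.up_mid hab h12.symm h23 h13 v213 (p1 ++ e2 :: r) s
        (by simpa using hl) (by simpa using hn) (by simpa using g213) (by simp) m)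
      exact this.swap12 h12

/-- lower inequality if the `baa` geodesic uses `e1` or misses `e2` -/
lemma FppSys.low_use1 (hs : FppSys f P V) (hab : a < b) (h12 : e1 ≠ e2) (h13 : e1 ≠ e3)
    (h23 : e2 ≠ e3) (hv : Valid3 V a b ω e1 e2 e3)
    (l : List E) (hl : l ∈ P) (hg : (l.map (env3 ω e1 b e2 a e3 a)).sum = f (env3 ω e1 b e2 a e3 a))
    (hm : e1 ∈ l ∨ e2 ∉ l) : LowIneq f a b ω e1 e2 e3 := by
  rcases hm with hm | hm
  · have k1 := hs.le _ (hv a a a (.inl rfl) (.inl rfl) (.inl rfl)) l hl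
    rw [env3_sum ω h12 h13 h23] at k1 hg
    have := List.count_pos_iff.2 hm
    have h1 : (1 : ℝ) ≤ (l.count e1 : ℝ) := by exact_mod_cast this
    have h2 : 0 ≤ (b - a) * ((l.count e1 : ℝ) - 1) := mul_nonneg (by linarith) (by linarith)
    have k2 := hs.lip1 hab hv (y := b) (z := a) (.inr rfl) (.inl rfl)
    have k3 := hs.lip1 hab hv (y := a) (z := b) (.inl rfl) (.inr rfl)
    have k4 := hs.cube hab hv (x := a) (y := b) (z := b) (x' := b) (y' := b) (z' := b)
      (by simp) (by simp) (by simp) (by simp) (by simp) (by simp) hab.le le_rfl le_rfl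
    unfold LowIneq
    linarith
  · have k1 := hs.le _ (hv b b a (.inr rfl) (.inr rfl) (.inl rfl)) l hl
    rw [env3_sum ω h12 h13 h23] at k1 hg
    rw [List.count_eq_zero_of_not_mem hm] at k1 hg
    have k2 := hs.cube hab hv (x := a) (y := a) (z := a) (x' := a) (y' := b) (z' := a)
      (by simp) (by simp) (by simp) (by simp) (by simp) (by simp) le_rfl hab.le le_rfl
    have k3 := hs.lip1 hab hv (y := a) (z := b) (.inl rfl) (.inr rfl)
    have k4 := hs.cube hab hv (x := a) (y := b) (z := b) (x' := b) (y' := b) (z' := b)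
      (by simp) (by simp) (by simp) (by simp) (by simp) (by simp) hab.le le_rfl le_rfl
    unfold LowIneq
    push_cast at *
    linarith

lemma FppSys.low_ex (hs : FppSys f P V) (hab : a < b) (h12 : e1 ≠ e2) (h13 : e1 ≠ e3)
    (h23 : e2 ≠ e3) (hv : Valid3 V a b ω e1 e2 e3)
    (p1 p2 q1 q2 : List E) (hl : p1 ++ e2 :: p2 ∈ P) (hn : (p1 ++ e2 :: p2).Nodup)
    (hg : ((p1 ++ e2 :: p2).map (env3 ω e1 b e2 a e3 a)).sum = f (env3 ω e1 b e2 a e3 a))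
    (hl' : q1 ++ e2 :: q2 ∈ P) (hn' : (q1 ++ e2 :: q2).Nodup)
    (hg' : ((q1 ++ e2 :: q2).map (env3 ω e1 a e2 a e3 b)).sum = f (env3 ω e1 a e2 a e3 b))
    (hp1 : e1 ∉ p1 ++ e2 :: p2) (hq3 : e3 ∉ q1 ++ e2 :: q2)
    (hm3 : e3 ∈ p2) (hm1 : e1 ∈ q1) : LowIneq f a b ω e1 e2 e3 := by
  have x1 := hs.exch _ (hv b a b (.inr rfl) (.inl rfl) (.inr rfl)) p1 e2 p2 q1 q2 hl hl'
  have x2 := hs.exch _ (hv a a a (.inl rfl) (.inl rfl) (.inl rfl)) q1 e2 q2 p1 p2 hl' hl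
  have c1 := List.nodup_iff_count_le_one.1 hn' e1
  have c3 := List.nodup_iff_count_le_one.1 hn e3
  have d1 := List.count_eq_zero_of_not_mem hp1
  have d3 := List.count_eq_zero_of_not_mem hq3
  have m1 := List.count_pos_iff.2 hm1
  have m3 := List.count_pos_iff.2 hm3
  have E2 : env3 ω e1 a e2 a e3 b e2 = a := by simp [env3, h12.symm]
  have E2' : env3 ω e1 b e2 a e3 a e2 = a := by simp [env3, h12.symm]
  have E2'' : env3 ω e1 a e2 a e3 a e2 = a := by simp [env3, h12.symm]
  have E2''' : env3 ω e1 b e2 a e3 b e2 = a := by simp [env3, h12.symm]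
  simp only [List.map_append, List.map_cons, List.sum_append, List.sum_cons, E2, E2', E2'', E2''']
    at x1 x2 hg hg'
  simp only [List.count_append, List.count_cons_self, List.count_cons_of_ne h12.symm,
    List.count_cons_of_ne h23] at c1 c3 d1 d3
  rw [env3_sum ω h12 h13 h23 b a b] at x1
  rw [env3_sum ω h12 h13 h23 b a b q2] at x1
  rw [env3_sum ω h12 h13 h23 a a a] at x2
  rw [env3_sum ω h12 h13 h23 a a a p2] at x2
  rw [env3_sum ω h12 h13 h23 b a a] at hg
  rw [env3_sum ω h12 h13 h23 b a a p2] at hg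
  rw [env3_sum ω h12 h13 h23 a a b] at hg'
  rw [env3_sum ω h12 h13 h23 a a b q2] at hg'
  have z1 : p1.count e1 = 0 := by omega
  have z2 : p2.count e1 = 0 := by omega
  have z3 : q1.count e3 = 0 := by omega
  have z4 : q2.count e3 = 0 := by omega
  have z5 : p1.count e3 = 0 := by omega
  have z6 : q2.count e1 = 0 := by omega
  rw [z1, z5] at x1 hg
  rw [z2] at x2 hg
  rw [z3, z4, z6] at hg'
  rw [z4, z6] at x1
  rw [z3] at x2
  have k2 := hs.lip1 hab hv (y := b) (z := a) (.inr rfl) (.inl rfl)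
  have k3 := hs.cube hab hv (x := a) (y := b) (z := b) (x' := b) (y' := b) (z' := b)
    (by simp) (by simp) (by simp) (by simp) (by simp) (by simp) hab.le le_rfl le_rfl
  unfold LowIneq
  push_cast at *
  linarith

/-- Two elements of a list come in one of two orders. -/
lemma two_order {l : List E} {e e' : E} (h : e ≠ e') (he : e ∈ l) (he' : e' ∈ l) :
    (∃ r s t, l = r ++ e :: (s ++ e' :: t)) ∨ (∃ r s t, l = r ++ e' :: (s ++ e :: t)) := by
  obtain ⟨p, q, rfl⟩ := List.append_of_mem he
  have : e' ∈ p ∨ e' ∈ q := by simpa [h.symm] using he'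
  rcases this with m | m
  · obtain ⟨r, s, rfl⟩ := List.append_of_mem m
    exact .inr ⟨r, s, q, by simp⟩
  · obtain ⟨r, s, rfl⟩ := List.append_of_mem m
    exact .inl ⟨p, r, s, rfl⟩

/-- `low_ex` phrased with relative orders -/
lemma FppSys.low_ord (hs : FppSys f P V) (hab : a < b) (h12 : e1 ≠ e2) (h13 : e1 ≠ e3)
    (h23 : e2 ≠ e3) (hv : Valid3 V a b ω e1 e2 e3)
    (p q : List E) (hl : p ∈ P) (hn : p.Nodup)
    (hg : (p.map (env3 ω e1 b e2 a e3 a)).sum = f (env3 ω e1 b e2 a e3 a))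
    (hl' : q ∈ P) (hn' : q.Nodup)
    (hg' : (q.map (env3 ω e1 a e2 a e3 b)).sum = f (env3 ω e1 a e2 a e3 b))
    (hp1 : e1 ∉ p) (hq3 : e3 ∉ q)
    (hp : ∃ r s t, p = r ++ e2 :: (s ++ e3 :: t)) (hq : ∃ r s t, q = r ++ e1 :: (s ++ e2 :: t)) :
    LowIneq f a b ω e1 e2 e3 := by
  obtain ⟨r, s, t, rfl⟩ := hp
  obtain ⟨r', s', t', rfl⟩ := hq
  have he : r' ++ e1 :: (s' ++ e2 :: t') = (r' ++ e1 :: s') ++ e2 :: t' := by simp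
  rw [he] at hl' hn' hg' hq3
  exact hs.low_ex hab h12 h13 h23 hv _ _ _ _ hl hn hg hl' hn' hg' hp1 hq3 (by simp) (by simp)

lemma FppSys.low (hs : FppSys f P V) (hab : a < b) (h12 : e1 ≠ e2) (h13 : e1 ≠ e3)
    (h23 : e2 ≠ e3) (hv : Valid3 V a b ω e1 e2 e3) : LowIneq f a b ω e1 e2 e3 := by
  obtain ⟨l1, hl1, hn1, hg1⟩ := hs.ex _ (hv b a a (.inr rfl) (.inl rfl) (.inl rfl))
  obtain ⟨l2, hl2, hn2, hg2⟩ := hs.ex _ (hv a b a (.inl rfl) (.inr rfl) (.inl rfl))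
  obtain ⟨l3, hl3, hn3, hg3⟩ := hs.ex _ (hv a a b (.inl rfl) (.inl rfl) (.inr rfl))
  have v213 := hv.swap12 h12
  have v132 := hv.swap23 h23
  have v231 := v213.swap23 h13
  have v312 := v132.swap12 h13
  have v321 := v231.swap12 h23
  have s213 := fun x y z => env3_swap12 ω (e3 := e3) h12 x y z
  have s132 := fun x y z => env3_swap23 ω (e1 := e1) h23 x y z
  have s231 : ∀ x y z, env3 ω e2 y e3 z e1 x = env3 ω e1 x e2 y e3 z := fun x y z => by
    rw [env3_swap23 ω h13, s213]
  have s312 : ∀ x y z, env3 ω e3 z e1 x e2 y = env3 ω e1 x e2 y e3 z := fun x y z => by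
    rw [env3_swap12 ω h13, s132]
  have s321 : ∀ x y z, env3 ω e3 z e2 y e1 x = env3 ω e1 x e2 y e3 z := fun x y z => by
    rw [env3_swap12 ω h23, s231]
  have t213 : LowIneq f a b ω e2 e1 e3 → LowIneq f a b ω e1 e2 e3 := fun h => h.swap12 h12
  have t132 : LowIneq f a b ω e1 e3 e2 → LowIneq f a b ω e1 e2 e3 := fun h => h.swap23 h23
  have t231 : LowIneq f a b ω e2 e3 e1 → LowIneq f a b ω e1 e2 e3 := fun h =>
    (h.swap23 h13).swap12 h12
  have t312 : LowIneq f a b ω e3 e1 e2 → LowIneq f a b ω e1 e2 e3 := fun h =>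
    (h.swap12 h13).swap23 h23
  have t321 : LowIneq f a b ω e3 e2 e1 → LowIneq f a b ω e1 e2 e3 := fun h =>
    t231 (h.swap12 h23)
  by_cases c12 : e1 ∈ l1 ∨ e2 ∉ l1
  · exact hs.low_use1 hab h12 h13 h23 hv l1 hl1 hg1 c12
  by_cases c13 : e1 ∈ l1 ∨ e3 ∉ l1
  · exact t132 (hs.low_use1 hab h13 h12 h23.symm v132 l1 hl1 (by rw [s132]; exact hg1) c13)
  by_cases c21 : e2 ∈ l2 ∨ e1 ∉ l2
  · exact t213 (hs.low_use1 hab h12.symm h23 h13 v213 l2 hl2 (by rw [s213]; exact hg2) c21)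
  by_cases c23 : e2 ∈ l2 ∨ e3 ∉ l2
  · exact t231 (hs.low_use1 hab h23 h12.symm h13.symm v231 l2 hl2 (by rw [s231]; exact hg2) c23)
  by_cases c31 : e3 ∈ l3 ∨ e1 ∉ l3
  · exact t312 (hs.low_use1 hab h13.symm h23.symm h12 v312 l3 hl3 (by rw [s312]; exact hg3) c31)
  by_cases c32 : e3 ∈ l3 ∨ e2 ∉ l3
  · exact t321 (hs.low_use1 hab h23.symm h13.symm h12.symm v321 l3 hl3
      (by rw [s321]; exact hg3) c32)
  push Not at c12 c13 c21 c23 c31 c32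
  have A123 := hs.low_ord hab h12 h13 h23 hv l1 l3 hl1 hn1 hg1 hl3 hn3 hg3 c12.1 c32.1
  have A321 := hs.low_ord hab h23.symm h13.symm h12.symm v321 l3 l1 hl3 hn3
    (by rw [s321]; exact hg3) hl1 hn1 (by rw [s321]; exact hg1) c31.1 c12.1
  have A213 := hs.low_ord hab h12.symm h23 h13 v213 l2 l3 hl2 hn2
    (by rw [s213]; exact hg2) hl3 hn3 (by rw [s213]; exact hg3) c21.1 c32.1
  have A312 := hs.low_ord hab h13.symm h23.symm h12 v312 l3 l2 hl3 hn3
    (by rw [s312]; exact hg3) hl2 hn2 (by rw [s312]; exact hg2) c31.1 c21.1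
  have A132 := hs.low_ord hab h13 h12 h23.symm v132 l1 l2 hl1 hn1
    (by rw [s132]; exact hg1) hl2 hn2 (by rw [s132]; exact hg2) c12.1 c21.1
  have A231 := hs.low_ord hab h23 h12.symm h13.symm v231 l2 l1 hl2 hn2
    (by rw [s231]; exact hg2) hl1 hn1 (by rw [s231]; exact hg1) c21.1 c12.1
  rcases two_order h23 c12.2 c13.2 with o1 | o1 <;>
  rcases two_order h13 c21.2 c23.2 with o2 | o2 <;>
  rcases two_order h12 c31.2 c32.2 with o3 | o3
  · exact A123 o1 o3
  · exact t213 (A213 o2 o3)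
  · exact A123 o1 o3
  · exact t231 (A231 o2 o1)
  · exact t132 (A132 o1 o2)
  · exact t321 (A321 o3 o1)
  · exact t312 (A312 o3 o2)
  · exact t321 (A321 o3 o1)

end three

lemma update3_eq_env3 (ω : E → ℝ) {e1 e2 e3 : E} (h12 : e1 ≠ e2) (h13 : e1 ≠ e3) (h23 : e2 ≠ e3)
    (x y z : ℝ) :
    Function.update (Function.update (Function.update ω e1 x) e2 y) e3 z
      = env3 ω e1 x e2 y e3 z := by
  funext e
  simp only [Function.update_apply, env3]
  by_cases h1 : e = e1
  · subst h1; simp [h12, h13]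
  · by_cases h2 : e = e2
    · subst h2; simp [h1, h23]
    · simp [h1, h2]

lemma FppSys.third (hs : FppSys f P V) {a b : ℝ} {ω : E → ℝ} {e1 e2 e3 : E} (hab : a < b)
    (h12 : e1 ≠ e2) (h13 : e1 ≠ e3) (h23 : e2 ≠ e3) (hv : Valid3 V a b ω e1 e2 e3) :
    |envDeriv a b e1 (envDeriv a b e2 (envDeriv a b e3 f)) ω| ≤ b - a := by
  have h1 := hs.up hab h12 h13 h23 hv
  have h2 := hs.low hab h12 h13 h23 hv
  unfold UpIneq at h1
  unfold LowIneq at h2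
  simp only [envDeriv, update3_eq_env3 ω h12 h13 h23]
  rw [abs_le]
  constructor <;> linarith

end AbstractPart

/-! ### Lattice paths -/

section LatticePart

lemma adjV_symm {d : ℕ} {x y : Vtx d} (h : adjV x y) : adjV y x := by
  unfold adjV at *
  rw [← h]
  exact Finset.sum_congr rfl (fun i _ => abs_sub_comm _ _)

lemma edgesOf_cons_cons {d : ℕ} (x y : Vtx d) (l : List (Vtx d)) :
    edgesOf (x :: y :: l) = s(x, y) :: edgesOf (y :: l) := by
  simp [edgesOf]

lemma edgesOf_single {d : ℕ} (x : Vtx d) : edgesOf [x] = [] := by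
  simp [edgesOf]

lemma edgesOf_append {d : ℕ} (p : List (Vtx d)) (x : Vtx d) (q : List (Vtx d)) :
    edgesOf (p ++ x :: q) = edgesOf (p ++ [x]) ++ edgesOf (x :: q) := by
  induction p with
  | nil => simp [edgesOf_single]
  | cons y p ih =>
    cases p with
    | nil => simp [edgesOf_cons_cons, edgesOf_single]
    | cons z p =>
      simp only [List.cons_append, edgesOf_cons_cons] at *
      rw [ih]

lemma edgesOf_mid {d : ℕ} (p : List (Vtx d)) (u v : Vtx d) (q : List (Vtx d)) :
    edgesOf (p ++ u :: v :: q) = edgesOf (p ++ [u]) ++ s(u, v) :: edgesOf (v :: q) := by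
  rw [edgesOf_append, edgesOf_cons_cons]

lemma pathTime_eq {d : ℕ} (ω : Sym2 (Vtx d) → ℝ) (p : List (Vtx d)) :
    pathTime ω p = ((edgesOf p).map ω).sum := by
  simp [pathTime, edgesOf, Function.comp_def]

lemma edgesOf_split {d : ℕ} (p1 : List (Sym2 (Vtx d))) (e : Sym2 (Vtx d))
    (p2 : List (Sym2 (Vtx d))) (p : List (Vtx d)) (h : edgesOf p = p1 ++ e :: p2) :
    ∃ (α : List (Vtx d)) (u v : Vtx d) (β : List (Vtx d)), p = α ++ u :: v :: β ∧ s(u, v) = e ∧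
      edgesOf (α ++ [u]) = p1 ∧ edgesOf (v :: β) = p2 := by
  induction p1 generalizing p with
  | nil =>
    match p with
    | [] => simp [edgesOf] at h
    | [x] => simp [edgesOf] at h
    | x :: y :: l =>
      rw [edgesOf_cons_cons] at h
      simp only [List.nil_append, List.cons.injEq] at h
      exact ⟨[], x, y, l, rfl, h.1, by simp [edgesOf_single], h.2⟩
  | cons c p1 ih =>
    match p with
    | [] => simp [edgesOf] at h
    | [x] => simp [edgesOf] at h
    | x :: y :: l =>
      rw [edgesOf_cons_cons] at h
      simp only [List.cons_append, List.cons.injEq] at h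
      obtain ⟨α, u, v, β, h1, h2, h3, h4⟩ := ih _ h.2
      refine ⟨x :: α, u, v, β, by simp [h1], h2, ?_, h4⟩
      cases α with
      | nil =>
        simp only [List.nil_append, List.cons.injEq] at h1
        rw [← h3, ← h.1]
        simp [edgesOf_cons_cons, h1.1]
      | cons z α =>
        simp only [List.cons_append, List.cons.injEq] at h1
        rw [← h3, ← h.1]
        simp [edgesOf_cons_cons, h1.1]

lemma edgesOf_mem {d : ℕ} (p : List (Vtx d)) (x y : Vtx d) (h : s(x, y) ∈ edgesOf p) : x ∈ p := by
  obtain ⟨p1, p2, hp⟩ := List.append_of_mem h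
  obtain ⟨α, u, v, β, h1, h2, -, -⟩ := edgesOf_split _ _ _ _ hp
  rw [h1]
  rcases Sym2.eq_iff.1 h2 with ⟨h, -⟩ | ⟨-, h⟩ <;> simp [h]

lemma edgesOf_nodup {d : ℕ} (p : List (Vtx d)) (h : p.Nodup) : (edgesOf p).Nodup := by
  induction p with
  | nil => simp [edgesOf]
  | cons x p ih =>
    cases p with
    | nil => simp [edgesOf]
    | cons y p =>
      rw [edgesOf_cons_cons, List.nodup_cons]
      rw [List.nodup_cons] at h
      exact ⟨fun hm => h.1 (edgesOf_mem _ _ _ hm), ih h.2⟩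

/-- gluing and splitting paths at a vertex -/
lemma isPath_glue {d n : ℕ} {u w x : Vtx d} {α β : List (Vtx d)} :
    IsPath n u w (α ++ x :: β) ↔ IsPath n u x (α ++ [x]) ∧ IsPath n x w (x :: β) := by
  unfold IsPath
  have hc : List.Chain' adjV (α ++ x :: β) ↔
      List.Chain' adjV (α ++ [x]) ∧ List.Chain' adjV (x :: β) := List.isChain_split
  have h1 : (α ++ x :: β).head? = (α ++ [x]).head? := by cases α <;> simp
  have h2 : (α ++ x :: β).getLast? = (x :: β).getLast? := by
    rw [List.getLast?_append]; simp [List.getLast?_cons]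
  rw [hc, h1, h2]
  simp only [List.mem_append, List.mem_cons, List.head?_cons, List.getLast?_append]
  constructor
  · rintro ⟨⟨a1, a2⟩, a3, a4, a5⟩
    refine ⟨⟨a1, a3, by simp, ?_⟩, a2, by simp, a4, ?_⟩
    · intro y hy; apply a5; simp at hy; tauto
    · intro y hy; apply a5; tauto
  · rintro ⟨⟨a1, a3, _, a6⟩, a2, _, a4, a5⟩
    refine ⟨⟨a1, a2⟩, a3, a4, ?_⟩
    intro y hy
    rcases hy with hy | hy | hy
    · exact a6 y (.inl hy)
    · exact a5 y (.inl hy)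
    · exact a5 y (.inr hy)

lemma isPath_cons {d n : ℕ} {u w x y : Vtx d} {β : List (Vtx d)}
    (h : IsPath n u w (x :: y :: β)) : u = x ∧ adjV x y ∧ inBox n x ∧ IsPath n y w (y :: β) := by
  unfold IsPath at *
  obtain ⟨h1, h2, h3, h4⟩ := h
  have h1' := List.isChain_cons_cons.1 h1
  refine ⟨by simpa using h2.symm, h1'.1, h4 _ (by simp), h1'.2, by simp, ?_, ?_⟩
  · simpa [List.getLast?_cons_cons] using h3
  · intro z hz; exact h4 z (by simp at hz ⊢; tauto)

lemma isPath_edges {d n : ℕ} {u w : Vtx d} {p : List (Vtx d)} (h : IsPath n u w p) :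
    ∀ e ∈ edgesOf p, e ∈ EdgeSet d n := by
  intro e he
  obtain ⟨p1, p2, hp⟩ := List.append_of_mem he
  obtain ⟨α, x, y, β, h1, h2, -, -⟩ := edgesOf_split _ _ _ _ hp
  subst h1
  have := isPath_cons (isPath_glue.1 h).2
  exact ⟨x, y, h2.symm, this.2.1, this.2.2.1, this.2.2.2.2.2.2 y (by simp)⟩

lemma isPath_single {d n : ℕ} {x : Vtx d} (hx : inBox n x) : IsPath n x x [x] :=
  ⟨List.isChain_singleton _, rfl, rfl, by simpa using hx⟩

lemma isPath_two {d n : ℕ} {x y : Vtx d} (hx : inBox n x) (hy : inBox n y) (h : adjV x y) :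
    IsPath n x y [x, y] := by
  refine ⟨?_, rfl, rfl, by simp [hx, hy]⟩
  exact List.isChain_pair.2 h

/-- A sequence of adjacent vertices gives a path. -/
lemma seq_path {d n : ℕ} (γ : ℕ → Vtx d) (L : ℕ) (hadj : ∀ k < L, adjV (γ k) (γ (k + 1)))
    (hbox : ∀ k ≤ L, inBox n (γ k)) :
    ∃ p, IsPath n (γ 0) (γ L) p ∧
      ∀ ω : Sym2 (Vtx d) → ℝ, pathTime ω p = ∑ k ∈ Finset.range L, ω s(γ k, γ (k + 1)) := by
  suffices H : ∃ p, IsPath n (γ 0) (γ L) (p ++ [γ L]) ∧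
      ∀ ω : Sym2 (Vtx d) → ℝ, pathTime ω (p ++ [γ L]) =
        ∑ k ∈ Finset.range L, ω s(γ k, γ (k + 1)) by
    obtain ⟨p, hp⟩ := H
    exact ⟨_, hp⟩
  induction L with
  | zero =>
    refine ⟨[], isPath_single (hbox 0 le_rfl), ?_⟩
    intro ω; simp [pathTime]
  | succ L ih =>
    obtain ⟨p, h1, h2⟩ := ih (fun k hk => hadj k (by omega)) (fun k hk => hbox k (by omega))
    have e : (p ++ [γ L]) ++ [γ (L + 1)] = p ++ γ L :: [γ (L + 1)] := by simp
    refine ⟨p ++ [γ L], ?_, ?_⟩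
    · rw [e, isPath_glue]
      exact ⟨h1, isPath_two (hbox _ (by omega)) (hbox _ le_rfl) (hadj _ (by omega))⟩
    · intro ω
      rw [e, pathTime_eq, edgesOf_append, List.map_append, List.sum_append, ← pathTime_eq, h2,
        Finset.sum_range_succ, edgesOf_cons_cons]
      simp [edgesOf]

/-- Monotone lattice path from `0` to `u`. -/
lemma mono_path {d : ℕ} (N : ℕ) : ∀ (u : Vtx d), (∑ j, |u j|) = (N : ℤ) →
    ∃ Q : ℕ → Vtx d, Q 0 = 0 ∧ Q N = u ∧ (∀ k < N, adjV (Q k) (Q (k + 1))) ∧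
      (∀ k ≤ N, ∀ j, |Q k j| ≤ |u j|) ∧ (∀ k ≤ N, ∑ j, (u j).sign * Q k j = (k : ℤ)) := by
  induction N with
  | zero =>
    intro u hu
    have hz : ∀ j, u j = 0 := by
      intro j
      have := (Finset.sum_eq_zero_iff_of_nonneg (fun j _ => abs_nonneg (u j))).1 hu j
        (Finset.mem_univ j)
      simpa using this
    refine ⟨fun _ => 0, rfl, ?_, by simp, by simp, ?_⟩
    · funext j; simp [hz j]
    · intro k hk; simp; omega
  | succ N ih =>
    intro u hu
    obtain ⟨j, hj⟩ : ∃ j, u j ≠ 0 := by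
      by_contra hcon
      push Not at hcon
      simp [hcon] at hu
      omega
    set u' : Vtx d := Function.update u j (u j - (u j).sign) with hu'
    have habs : |u j - (u j).sign| = |u j| - 1 := by
      rcases lt_or_gt_of_ne hj with h | h
      · rw [Int.sign_eq_neg_one_of_neg h, abs_of_neg h, abs_of_nonpos (by omega)]; ring
      · rw [Int.sign_eq_one_of_pos h, abs_of_pos h, abs_of_nonneg (by omega)]
    have hne : ∀ i, i ≠ j → u' i = u i := fun i hi => by simp [hu', hi]
    have hjj : u' j = u j - (u j).sign := by simp [hu']
    have hsum : ∑ i, |u' i| = (N : ℤ) := by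
      rw [← Finset.add_sum_erase _ _ (Finset.mem_univ j)] at hu ⊢
      rw [Finset.sum_congr rfl (g := fun i => |u i|)
        (fun i hi => by rw [hne i (Finset.ne_of_mem_erase hi)]), hjj, habs]
      push_cast at hu
      linarith
    obtain ⟨Q, q0, qN, qa, qb, qs⟩ := ih u' hsum
    have hle : ∀ i, |u' i| ≤ |u i| := by
      intro i
      by_cases hi : i = j
      · subst hi; rw [hjj, habs]; omega
      · rw [hne i hi]
    have hsgn : ∀ (x : Vtx d), (∀ i, |x i| ≤ |u' i|) →
        ∑ i, (u i).sign * x i = ∑ i, (u' i).sign * x i := by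
      intro x hx
      refine Finset.sum_congr rfl (fun i _ => ?_)
      by_cases hi : i = j
      · subst hi
        have h1 := hx i
        by_cases h0 : u' i = 0
        · rw [h0] at h1; simp at h1; simp [h1]
        · congr 1
          rw [hjj] at h0 ⊢
          rcases lt_or_gt_of_ne hj with h | h
          · rw [Int.sign_eq_neg_one_of_neg h] at h0 ⊢
            rw [Int.sign_eq_neg_one_of_neg]; omega
          · rw [Int.sign_eq_one_of_pos h] at h0 ⊢
            rw [Int.sign_eq_one_of_pos]; omega
      · rw [hne i hi]
    refine ⟨fun k => if k ≤ N then Q k else u, by simp [q0], by simp, ?_, ?_, ?_⟩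
    · intro k hk
      by_cases h : k + 1 ≤ N
      · simp only [h, if_true, show k ≤ N by omega]
        exact qa k (by omega)
      · have : k = N := by omega
        subst this
        simp only [le_refl, if_true, h, if_false, qN]
        unfold adjV
        rw [Finset.sum_eq_single j]
        · rw [hjj]
          rcases lt_or_gt_of_ne hj with h | h
          · rw [Int.sign_eq_neg_one_of_neg h]; simp
          · rw [Int.sign_eq_one_of_pos h]; simp
        · intro i _ hi; simp [hne i hi]
        · simp
    · intro k hk i
      by_cases h : k ≤ N
      · simp only [h, if_true]
        exact (qb k h i).trans (hle i)
      · simp [h]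
    · intro k hk
      by_cases h : k ≤ N
      · simp only [h, if_true]
        rw [hsgn _ (qb k h), qs k h]
      · have : k = N + 1 := by omega
        subst this
        simp only [h, if_false]
        rw [← hu]
        exact Finset.sum_congr rfl (fun i _ => Int.sign_mul_self_eq_abs (u i))

lemma exists_path {d n : ℕ} (w : Vtx d) (hw : inBox n w) : ∃ p, IsPath n 0 w p := by
  have hnn : 0 ≤ ∑ j, |w j| := Finset.sum_nonneg (fun j _ => abs_nonneg _)
  obtain ⟨Q, q0, qN, qa, qb, -⟩ := mono_path (∑ j, |w j|).toNat w (by rw [Int.toNat_of_nonneg hnn])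
  obtain ⟨p, hp, -⟩ := seq_path (n := n) Q _ qa (fun k hk j => (qb k hk j).trans (hw j))
  rw [q0, qN] at hp
  exact ⟨p, hp⟩

lemma env_pos {d n : ℕ} {a b : ℝ} (ha : 0 < a) (hab : a < b) {ω : Sym2 (Vtx d) → ℝ}
    (hω : ValidEnv d n a b ω) {e : Sym2 (Vtx d)} (he : e ∈ EdgeSet d n) : 0 < ω e := by
  rcases hω e he with h | h <;> rw [h] <;> linarith

lemma pathTime_nonneg {d n : ℕ} {a b : ℝ} (ha : 0 < a) (hab : a < b) {ω : Sym2 (Vtx d) → ℝ}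
    (hω : ValidEnv d n a b ω) {u w : Vtx d} {p : List (Vtx d)} (hp : IsPath n u w p) :
    0 ≤ pathTime ω p := by
  rw [pathTime_eq]
  refine List.sum_nonneg (fun x hx => ?_)
  obtain ⟨e, he, rfl⟩ := List.mem_map.1 hx
  exact (env_pos ha hab hω (isPath_edges hp e he)).le

lemma fpp_le {d n : ℕ} {a b : ℝ} (ha : 0 < a) (hab : a < b) {ω : Sym2 (Vtx d) → ℝ}
    (hω : ValidEnv d n a b ω) {v : Vtx d} {p : List (Vtx d)}
    (hp : IsPath n 0 (fun i => (n : ℤ) * v i) p) : fppT d v n ω ≤ pathTime ω p := by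
  refine csInf_le ⟨0, ?_⟩ ⟨p, hp, rfl⟩
  rintro t ⟨q, hq, rfl⟩
  exact pathTime_nonneg ha hab hω hq

lemma exists_min {d n : ℕ} {a b : ℝ} (ha : 0 < a) (hab : a < b) {ω : Sym2 (Vtx d) → ℝ}
    (hω : ValidEnv d n a b ω) {v : Vtx d} (hv : inBox n (fun i => (n : ℤ) * v i)) :
    ∃ p, IsPath n 0 (fun i => (n : ℤ) * v i) p ∧ pathTime ω p = fppT d v n ω := by
  set T : Set ℝ := {t : ℝ | ∃ p : List (Vtx d), IsPath n 0 (fun i => (n : ℤ) * v i) p ∧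
    t = pathTime ω p} with hT
  have hne : T.Nonempty := by
    obtain ⟨p, hp⟩ := exists_path (n := n) _ hv
    exact ⟨_, p, hp, rfl⟩
  have hmono : Monotone (fun q : ℕ × ℕ => a * (q.1 : ℝ) + b * (q.2 : ℝ)) := by
    intro q r hqr
    have h1 : (q.1 : ℝ) ≤ r.1 := by exact_mod_cast hqr.1
    have h2 : (q.2 : ℝ) ≤ r.2 := by exact_mod_cast hqr.2
    have hb : 0 < b := ha.trans hab
    dsimp only
    gcongr
  have hwf : ((fun q : ℕ × ℕ => a * (q.1 : ℝ) + b * (q.2 : ℝ)) '' Set.univ).IsWF :=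
    ((Set.isPWO_of_wellQuasiOrderedLE (Set.univ : Set (ℕ × ℕ))).image_of_monotone hmono).isWF
  have key : ∀ l : List (Sym2 (Vtx d)), (∀ e ∈ l, e ∈ EdgeSet d n) →
      ∃ i j : ℕ, a * (i : ℝ) + b * (j : ℝ) = (l.map ω).sum := by
    intro l
    induction l with
    | nil => intro _; exact ⟨0, 0, by simp⟩
    | cons e l ih =>
      intro hl
      obtain ⟨i, j, hij⟩ := ih (fun e he => hl e (by simp [he]))
      rcases hω e (hl e (by simp)) with h | h
      · exact ⟨i + 1, j, by simp [h, ← hij]; ring⟩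
      · exact ⟨i, j + 1, by simp [h, ← hij]; ring⟩
  have hsub : T ⊆ ((fun q : ℕ × ℕ => a * (q.1 : ℝ) + b * (q.2 : ℝ)) '' Set.univ) := by
    rintro t ⟨p, hp, rfl⟩
    obtain ⟨i, j, h⟩ := key _ (isPath_edges hp)
    exact ⟨(i, j), trivial, by rw [pathTime_eq]; exact h⟩
  have hwfT : T.IsWF := hwf.mono hsub
  obtain ⟨p, hp, hpt⟩ := hwfT.min_mem hne
  refine ⟨p, hp, le_antisymm ?_ (fpp_le ha hab hω hp)⟩
  refine le_csInf hne (fun t ht => ?_)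
  rw [← hpt]
  exact hwfT.min_le hne ht

lemma not_nodup_split {α : Type*} (p : List α) (h : ¬ p.Nodup) :
    ∃ x p1 p2 p3, p = p1 ++ x :: (p2 ++ x :: p3) := by
  induction p with
  | nil => simp at h
  | cons y l ih =>
    by_cases hy : y ∈ l
    · obtain ⟨r, s, rfl⟩ := List.append_of_mem hy
      exact ⟨y, [], r, s, by simp⟩
    · rw [List.nodup_cons] at h
      obtain ⟨x, p1, p2, p3, rfl⟩ := ih (fun hn => h ⟨hy, hn⟩)
      exact ⟨x, y :: p1, p2, p3, by simp⟩

lemma min_nodup {d n : ℕ} {a b : ℝ} (ha : 0 < a) (hab : a < b) {ω : Sym2 (Vtx d) → ℝ}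
    (hω : ValidEnv d n a b ω) {v : Vtx d} {p : List (Vtx d)}
    (hp : IsPath n 0 (fun i => (n : ℤ) * v i) p) (hm : pathTime ω p = fppT d v n ω) : p.Nodup := by
  by_contra hn
  obtain ⟨x, p1, p2, p3, rfl⟩ := not_nodup_split p hn
  have h1 := isPath_glue.1 hp
  have e : x :: (p2 ++ x :: p3) = (x :: p2) ++ x :: p3 := by simp
  have h2 := h1.2
  rw [e] at h2
  have h2 := isPath_glue.1 h2
  have h3 := fpp_le ha hab hω (isPath_glue.2 ⟨h1.1, h2.2⟩)
  rw [← hm, pathTime_eq, pathTime_eq, edgesOf_append p1 x p3, edgesOf_append p1 x (p2 ++ x :: p3), e,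
    edgesOf_append (x :: p2)] at h3
  simp only [List.map_append, List.sum_append] at h3
  have hpos : 0 < ((edgesOf (x :: p2 ++ [x])).map ω).sum := by
    apply List.sum_pos
    · intro t ht
      obtain ⟨e, he, rfl⟩ := List.mem_map.1 ht
      exact env_pos ha hab hω (isPath_edges h2.1 e he)
    · cases p2 <;> simp [edgesOf]
  linarith

lemma fpp_sys {d n : ℕ} {a b : ℝ} (ha : 0 < a) (hab : a < b) {v : Vtx d}
    (hv : inBox n (fun i => (n : ℤ) * v i)) :
    FppSys (fppT d v n) {l | ∃ p, IsPath n 0 (fun i => (n : ℤ) * v i) p ∧ edgesOf p = l}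
      (ValidEnv d n a b) where
  le := by
    rintro ω hω l ⟨p, hp, rfl⟩
    rw [← pathTime_eq]
    exact fpp_le ha hab hω hp
  ex := by
    intro ω hω
    obtain ⟨p, hp, hm⟩ := exists_min ha hab hω hv
    exact ⟨_, ⟨p, hp, rfl⟩, edgesOf_nodup _ (min_nodup ha hab hω hp hm), by rw [← pathTime_eq, hm]⟩
  exch := by
    rintro ω hω p1 e p2 q1 q2 ⟨p, hp, hpe⟩ ⟨q, hq, hqe⟩
    have heE : 0 < ω e := env_pos ha hab hω (isPath_edges hp e (by simp [hpe]))
    obtain ⟨α, u, w, β, rfl, h2, h3, h4⟩ := edgesOf_split _ _ _ _ hpe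
    obtain ⟨α', u', w', β', rfl, h2', h3', h4'⟩ := edgesOf_split _ _ _ _ hqe
    subst h2 h3 h4 h3' h4'
    have hp1 := isPath_glue.1 hp
    have hq1 := isPath_glue.1 hq
    rcases Sym2.eq_iff.1 h2' with ⟨rfl, rfl⟩ | ⟨rfl, rfl⟩
    · have := fpp_le ha hab hω (isPath_glue.2 ⟨hp1.1, hq1.2⟩)
      rw [pathTime_eq, edgesOf_mid] at this
      simp only [List.map_append, List.sum_append, List.map_cons, List.sum_cons] at this
      linarith
    · have := fpp_le ha hab hω (isPath_glue.2 ⟨hp1.1, (isPath_cons hq1.2).2.2.2⟩)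
      rw [pathTime_eq, edgesOf_append] at this
      simp only [List.map_append, List.sum_append] at this
      linarith

lemma fourth_bound {d n : ℕ} {a b : ℝ} (ha : 0 < a) (hab : a < b) {v : Vtx d}
    (hv : inBox n (fun i => (n : ℤ) * v i)) (S : Finset (Sym2 (Vtx d))) (hS : S.card = 4)
    (ω : Sym2 (Vtx d) → ℝ) (hω : ValidEnv d n a b ω) :
    -(2 * (b - a)) ≤ envDerivOn a b S (fppT d v n) ω ∧
        envDerivOn a b S (fppT d v n) ω ≤ 2 * (b - a) := by
  have hl : S.toList.length = 4 := by simp [hS]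
  have hn := S.nodup_toList
  unfold envDerivOn
  generalize S.toList = l at hl hn
  match l, hl with
  | [e0, e1, e2, e3], _ =>
    simp only [List.nodup_cons, List.mem_cons, List.not_mem_nil, or_false, not_or] at hn
    simp only [List.foldr_cons, List.foldr_nil]
    have hs := fpp_sys ha hab hv
    have H : ∀ t, t = a ∨ t = b →
        |envDeriv a b e1 (envDeriv a b e2 (envDeriv a b e3 (fppT d v n)))
          (Function.update ω e0 t)| ≤ b - a := by
      intro t ht
      refine hs.third hab hn.2.1.1 hn.2.1.2 hn.2.2.1 ?_
      intro x y z hx hy hz e he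
      unfold env3
      split_ifs
      · exact hx
      · exact hy
      · exact hz
      · rw [Function.update_apply]
        split_ifs
        · exact ht
        · exact hω e he
    have h1 := abs_le.1 (H a (.inl rfl))
    have h2 := abs_le.1 (H b (.inr rfl))
    rw [envDeriv]
    constructor <;> linarith [h1.1, h1.2, h2.1, h2.2]

end LatticePart

/-! ### Two parallel highways -/

section CyclePart

/-- Two induced, internally disjoint paths of length `L` from `0` to `w`, with a height. -/
structure TwoRoads (d n : ℕ) (a b : ℝ) (w : Vtx d) (L : ℕ) (γ : Bool → ℕ → Vtx d)
    (H : Vtx d → ℝ) : Prop where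
  hL : 3 ≤ L
  start : ∀ i, γ i 0 = 0
  fin : ∀ i, γ i L = w
  adj : ∀ i, ∀ k < L, adjV (γ i k) (γ i (k + 1))
  box : ∀ i, ∀ k ≤ L, inBox n (γ i k)
  ht : ∀ i, ∀ k ≤ L, H (γ i k) = a * (k : ℝ)
  disj : ∀ i j, ∀ k ≤ L, γ i k = γ j k → i = j ∨ k = 0 ∨ k = L
  chord : ∀ i j k l, k ≤ l → l ≤ L → adjV (γ i k) (γ j l) → l = k + 1 ∧ (i = j ∨ k = 0 ∨ l = L)
  grad : ∀ x y, adjV x y → |H x - H y| ≤ a ∨ (|H x - H y| ≤ b ∧ (∀ i, ∀ k ≤ L, γ i k ≠ x) ∧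
    (∀ i, ∀ k ≤ L, γ i k ≠ y))

variable {d n : ℕ} {a b : ℝ} {w : Vtx d} {L : ℕ} {γ : Bool → ℕ → Vtx d} {H : Vtx d → ℝ}

/-- edges of the roads -/
def roadEdge (γ : Bool → ℕ → Vtx d) (i : Bool) (k : ℕ) : Sym2 (Vtx d) := s(γ i k, γ i (k + 1))

/-- environment with weights `W` on the roads and `b` elsewhere -/
def RoadEnv (a b : ℝ) (L : ℕ) (γ : Bool → ℕ → Vtx d) (W : Bool → ℕ → ℕ) (ω : Sym2 (Vtx d) → ℝ) :
    Prop :=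
  (∀ i, ∀ k < L, ω (roadEdge γ i k) = a + (b - a) * (W i k : ℝ)) ∧
  (∀ e, (∀ i, ∀ k < L, e ≠ roadEdge γ i k) → ω e = b)

lemma TwoRoads.time_eq (R : TwoRoads d n a b w L γ H) (ha : 0 < a) {i j : Bool} {k l : ℕ}
    (hk : k ≤ L) (hl : l ≤ L) (h : γ i k = γ j l) : k = l := by
  have h1 := R.ht i k hk
  rw [h, R.ht j l hl] at h1
  have := mul_left_cancel₀ ha.ne' h1
  exact_mod_cast this.symm

lemma TwoRoads.edge_inj (R : TwoRoads d n a b w L γ H) (ha : 0 < a) {i j : Bool} {k l : ℕ}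
    (hk : k < L) (hl : l < L) (h : roadEdge γ i k = roadEdge γ j l) : i = j ∧ k = l := by
  have hL := R.hL
  rcases Sym2.eq_iff.1 h with ⟨h1, h2⟩ | ⟨h1, h2⟩
  · have := R.time_eq ha hk.le hl.le h1
    subst this
    rcases R.disj i j k hk.le h1 with h | h | h
    · exact ⟨h, rfl⟩
    · rcases R.disj i j (k + 1) hk h2 with h' | h' | h'
      · exact ⟨h', rfl⟩
      · omega
      · omega
    · omega
  · have := R.time_eq ha hk.le hl h1
    have := R.time_eq ha hk hl.le h2
    omega

/-- A potential bounds the passage time from below. -/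
lemma potential_le {ω : Sym2 (Vtx d) → ℝ} (φ : Vtx d → ℝ)
    (hφ : ∀ x y, adjV x y → φ y - φ x ≤ ω s(x, y)) (p : List (Vtx d)) :
    ∀ u, IsPath n u w p → φ w - φ u ≤ pathTime ω p := by
  induction p with
  | nil => intro u h; simp [IsPath] at h
  | cons x p ih =>
    cases p with
    | nil =>
      intro u h
      have h1 : x = u := by simpa using h.2.1
      have h2 : x = w := by simpa using h.2.2.1
      subst h1; subst h2
      simp [pathTime]
    | cons y p =>
      intro u h
      obtain ⟨rfl, h2, -, h4⟩ := isPath_cons h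
      have h5 := ih y h4
      have h6 := hφ _ _ h2
      rw [pathTime_eq, edgesOf_cons_cons, List.map_cons, List.sum_cons, ← pathTime_eq]
      linarith

open Classical in
/-- the correction to the potential -/
def extraPot (L : ℕ) (γ : Bool → ℕ → Vtx d) (W : Bool → ℕ → ℕ) (K : ℕ) (x : Vtx d) : ℕ :=
  if h : ∃ q : Bool × ℕ, q.2 ≤ L ∧ γ q.1 q.2 = x then
    min K (∑ k ∈ Finset.range h.choose.2, W h.choose.1 k) else 1

lemma TwoRoads.extra_on (R : TwoRoads d n a b w L γ H) (ha : 0 < a) (W : Bool → ℕ → ℕ) (K : ℕ)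
    (hK : ∀ i, K ≤ ∑ k ∈ Finset.range L, W i k) (i : Bool) (k : ℕ) (hk : k ≤ L) :
    extraPot L γ W K (γ i k) = min K (∑ l ∈ Finset.range k, W i l) := by
  have h : ∃ q : Bool × ℕ, q.2 ≤ L ∧ γ q.1 q.2 = γ i k := ⟨(i, k), hk, rfl⟩
  unfold extraPot
  rw [dif_pos h]
  obtain ⟨h1, h2⟩ := h.choose_spec
  generalize h.choose = q at h1 h2
  obtain ⟨j, l⟩ := q
  dsimp only at *
  have := R.time_eq ha h1 hk h2
  subst this
  rcases R.disj _ _ _ hk h2 with rfl | rfl | rfl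
  · rfl
  · simp
  · rw [min_eq_left (hK j), min_eq_left (hK i)]

lemma extra_off (W : Bool → ℕ → ℕ) (K : ℕ) (x : Vtx d)
    (hx : ¬ ∃ q : Bool × ℕ, q.2 ≤ L ∧ γ q.1 q.2 = x) :
    extraPot L γ W K x = 1 := by
  unfold extraPot
  rw [dif_neg hx]

lemma TwoRoads.extra_le (R : TwoRoads d n a b w L γ H) (ha : 0 < a) (W : Bool → ℕ → ℕ) (K : ℕ)
    (hK : ∀ i, K ≤ ∑ k ∈ Finset.range L, W i k) (hK2 : K ≤ 2) (x : Vtx d) :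
    extraPot L γ W K x ≤ 2 := by
  by_cases hx : ∃ q : Bool × ℕ, q.2 ≤ L ∧ γ q.1 q.2 = x
  · obtain ⟨q, h1, rfl⟩ := hx
    rw [R.extra_on ha W K hK _ _ h1]
    omega
  · rw [extra_off W K x hx]; omega

lemma TwoRoads.pot (R : TwoRoads d n a b w L γ H) (ha : 0 < a) (hab : a < b) (W : Bool → ℕ → ℕ)
    (K : ℕ) (hK : ∀ i, K ≤ ∑ k ∈ Finset.range L, W i k) (hK2 : K ≤ 2)
    {ω : Sym2 (Vtx d) → ℝ} (hω : RoadEnv a b L γ W ω) (x y : Vtx d) (hxy : adjV x y) :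
    |(H y + (b - a) * (extraPot L γ W K y : ℝ)) - (H x + (b - a) * (extraPot L γ W K x : ℝ))|
      ≤ ω s(x, y) := by
  have hδ : 0 < b - a := by linarith
  -- one step along a road
  have step : ∀ i, ∀ k < L, ∀ x y, x = γ i k → y = γ i (k + 1) →
      |(H y + (b - a) * (extraPot L γ W K y : ℝ)) - (H x + (b - a) * (extraPot L γ W K x : ℝ))|
      ≤ ω s(x, y) := by
    rintro i k hk x y rfl rfl
    have h1 := hω.1 i k hk
    unfold roadEdge at h1
    rw [h1, R.ht i k hk.le, R.ht i (k + 1) hk, R.extra_on ha W K hK i k hk.le,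
      R.extra_on ha W K hK i (k + 1) hk, Finset.sum_range_succ]
    set s := ∑ l ∈ Finset.range k, W i l
    have e1 : min K s ≤ min K (s + W i k) := by omega
    have e2 : min K (s + W i k) ≤ min K s + W i k := by omega
    have e1' : ((min K s : ℕ) : ℝ) ≤ ((min K (s + W i k) : ℕ) : ℝ) := by exact_mod_cast e1
    have e2' : ((min K (s + W i k) : ℕ) : ℝ) ≤ ((min K s : ℕ) : ℝ) + (W i k : ℝ) := by
      exact_mod_cast e2
    have f1 := mul_le_mul_of_nonneg_left e1' hδ.le
    have f2 := mul_le_mul_of_nonneg_left e2' hδ.le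
    rw [mul_add] at f2
    push_cast at *
    rw [abs_le]
    constructor <;> linarith
  -- ordered version for two road vertices
  have road : ∀ i j k l, k ≤ l → l ≤ L → adjV (γ i k) (γ j l) →
      ∃ i', ∃ k' < L, γ i k = γ i' k' ∧ γ j l = γ i' (k' + 1) := by
    intro i j k l hkl hl h
    obtain ⟨rfl, h2⟩ := R.chord i j k l hkl hl h
    rcases h2 with rfl | rfl | rfl
    · exact ⟨i, k, hl, rfl, rfl⟩
    · exact ⟨j, 0, hl, by rw [R.start, R.start], rfl⟩
    · exact ⟨i, k, hl, rfl, by rw [R.fin, R.fin]⟩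
  have comm : ω s(x, y) = ω s(y, x) := by rw [Sym2.eq_swap]
  by_cases hx : ∃ q : Bool × ℕ, q.2 ≤ L ∧ γ q.1 q.2 = x
  · by_cases hy : ∃ q : Bool × ℕ, q.2 ≤ L ∧ γ q.1 q.2 = y
    · obtain ⟨⟨i, k⟩, hk, rfl⟩ := hx
      obtain ⟨⟨j, l⟩, hl, rfl⟩ := hy
      dsimp only at *
      rcases le_total k l with h | h
      · obtain ⟨i', k', h1, h2, h3⟩ := road i j k l h hl hxy
        exact step i' k' h1 _ _ h2 h3
      · obtain ⟨i', k', h1, h2, h3⟩ := road j i l k h hk (adjV_symm hxy)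
        rw [abs_sub_comm, comm]
        exact step i' k' h1 _ _ h2 h3
    · have hb : ω s(x, y) = b := by
        refine hω.2 _ (fun i k hk h => ?_)
        rcases Sym2.eq_iff.1 h with ⟨-, h⟩ | ⟨-, h⟩
        · exact hy ⟨(i, k + 1), hk, h.symm⟩
        · exact hy ⟨(i, k), hk.le, h.symm⟩
      have hg : |H x - H y| ≤ a := by
        rcases R.grad x y hxy with h | h
        · exact h
        · obtain ⟨q, h1, h2⟩ := hx
          exact absurd h2 (h.2.1 _ _ h1)
      rw [hb, extra_off W K y hy]
      have h2 := R.extra_le ha W K hK hK2 x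
      have h2' : (extraPot L γ W K x : ℝ) ≤ 2 := by exact_mod_cast h2
      have h0' : (0 : ℝ) ≤ (extraPot L γ W K x : ℝ) := Nat.cast_nonneg _
      have f1 := mul_le_mul_of_nonneg_left h2' hδ.le
      have f2 := mul_nonneg hδ.le h0'
      rw [abs_le] at hg ⊢
      push_cast
      constructor <;> linarith [hg.1, hg.2]
  · have hb : ω s(x, y) = b := by
      refine hω.2 _ (fun i k hk h => ?_)
      rcases Sym2.eq_iff.1 h with ⟨h, -⟩ | ⟨h, -⟩
      · exact hx ⟨(i, k), hk.le, h.symm⟩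
      · exact hx ⟨(i, k + 1), hk, h.symm⟩
    rw [hb, extra_off W K x hx]
    by_cases hy : ∃ q : Bool × ℕ, q.2 ≤ L ∧ γ q.1 q.2 = y
    · have hg : |H x - H y| ≤ a := by
        rcases R.grad x y hxy with h | h
        · exact h
        · obtain ⟨q, h1, h2⟩ := hy
          exact absurd h2 (h.2.2 _ _ h1)
      have h2 := R.extra_le ha W K hK hK2 y
      have h2' : (extraPot L γ W K y : ℝ) ≤ 2 := by exact_mod_cast h2
      have h0' : (0 : ℝ) ≤ (extraPot L γ W K y : ℝ) := Nat.cast_nonneg _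
      have f1 := mul_le_mul_of_nonneg_left h2' hδ.le
      have f2 := mul_nonneg hδ.le h0'
      rw [abs_le] at hg ⊢
      push_cast
      constructor <;> linarith [hg.1, hg.2]
    · rw [extra_off W K y hy]
      have hg : |H x - H y| ≤ b := by
        rcases R.grad x y hxy with h | h
        · linarith
        · exact h.1
      rw [abs_le] at hg ⊢
      constructor <;> linarith [hg.1, hg.2]

lemma TwoRoads.road_mem (R : TwoRoads d n a b w L γ H) (i : Bool) (k : ℕ) (hk : k < L) :
    roadEdge γ i k ∈ EdgeSet d n :=
  ⟨_, _, rfl, R.adj i k hk, R.box i k hk.le, R.box i (k + 1) hk⟩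

lemma RoadEnv.valid {W : Bool → ℕ → ℕ} {ω : Sym2 (Vtx d) → ℝ} (hω : RoadEnv a b L γ W ω)
    (hW : ∀ i k, W i k ≤ 1) : ValidEnv d n a b ω := by
  intro e _
  by_cases h : ∃ i, ∃ k < L, e = roadEdge γ i k
  · obtain ⟨i, k, hk, rfl⟩ := h
    rw [hω.1 i k hk]
    have := hW i k
    interval_cases W i k
    · left; simp
    · right; simp
  · push Not at h
    right; exact hω.2 e h

/-- The passage time in a road environment. -/
lemma TwoRoads.time {v : Vtx d} (R : TwoRoads d n a b (fun i => (n : ℤ) * v i) L γ H) (ha : 0 < a)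
    (hab : a < b) (W : Bool → ℕ → ℕ) (hW : ∀ i k, W i k ≤ 1) (A B : ℕ)
    (hA : ∑ k ∈ Finset.range L, W true k = A) (hB : ∑ k ∈ Finset.range L, W false k = B)
    (h2 : min A B ≤ 2) {ω : Sym2 (Vtx d) → ℝ} (hω : RoadEnv a b L γ W ω) :
    fppT d v n ω = a * (L : ℝ) + (b - a) * ((min A B : ℕ) : ℝ) := by
  have hδ : 0 < b - a := by linarith
  have hvalid : ValidEnv d n a b ω := hω.valid hW
  have hK : ∀ i, min A B ≤ ∑ k ∈ Finset.range L, W i k := by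
    intro i; cases i
    · rw [hB]; omega
    · rw [hA]; omega
  have up : ∀ i, fppT d v n ω ≤ a * (L : ℝ) + (b - a) * ((∑ k ∈ Finset.range L, W i k : ℕ) : ℝ) := by
    intro i
    obtain ⟨p, hp, ht⟩ := seq_path (n := n) (γ i) L (R.adj i) (R.box i)
    rw [R.start, R.fin] at hp
    refine (fpp_le ha hab hvalid hp).trans (le_of_eq ?_)
    have hh : ∀ k ∈ Finset.range L, ω s(γ i k, γ i (k + 1)) = a + (b - a) * (W i k : ℝ) :=
      fun k hk => hω.1 i k (Finset.mem_range.1 hk)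
    rw [ht, Finset.sum_congr rfl hh,
      Finset.sum_add_distrib, ← Finset.mul_sum]
    simp [mul_comm]
  apply le_antisymm
  · have u1 := up true
    have u2 := up false
    rw [hA] at u1
    rw [hB] at u2
    rcases min_choice A B with h | h <;> rw [h] <;> assumption
  · unfold fppT
    refine le_csInf ?_ ?_
    · obtain ⟨p, hp, ht⟩ := seq_path (n := n) (γ true) L (R.adj true) (R.box true)
      rw [R.start, R.fin] at hp
      exact ⟨_, p, hp, rfl⟩
    · rintro t ⟨p, hp, rfl⟩
      have := potential_le (n := n) (ω := ω)
        (fun x => H x + (b - a) * (extraPot L γ W (min A B) x : ℝ))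
        (fun x y hxy => (abs_le.1 (R.pot ha hab W (min A B) hK h2 hω x y hxy)).2) p 0 hp
      refine le_trans (le_of_eq ?_) this
      have e0 := R.extra_on ha W (min A B) hK true 0 (Nat.zero_le _)
      have e1 := R.extra_on ha W (min A B) hK true L le_rfl
      have g0 := R.ht true 0 (Nat.zero_le _)
      have g1 := R.ht true L le_rfl
      rw [R.start] at e0 g0
      rw [R.fin] at e1 g1
      rw [min_eq_left (hK true)] at e1
      rw [e0, e1, g0, g1]
      simp

/-- the weights: three edges on the first road, two on the second -/
def wts (x0 x1 x2 y0 y1 : ℕ) : Bool → ℕ → ℕ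
  | true, 0 => x0
  | true, 1 => x1
  | true, 2 => x2
  | false, 0 => y0
  | false, 1 => y1
  | _, _ => 0

lemma wts_sum_true (x0 x1 x2 y0 y1 : ℕ) (hL : 3 ≤ L) :
    ∑ k ∈ Finset.range L, wts x0 x1 x2 y0 y1 true k = x0 + x1 + x2 := by
  obtain ⟨m, rfl⟩ := Nat.exists_eq_add_of_le hL
  rw [Finset.sum_range_add]
  simp only [Finset.sum_range_succ, Finset.sum_range_zero]
  rw [Finset.sum_eq_zero]
  · simp [wts]
  · intro k _
    rw [show 3 + k = k + 3 by ring]; rfl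

lemma wts_sum_false (x0 x1 x2 y0 y1 : ℕ) (hL : 3 ≤ L) :
    ∑ k ∈ Finset.range L, wts x0 x1 x2 y0 y1 false k = y0 + y1 := by
  obtain ⟨m, rfl⟩ := Nat.exists_eq_add_of_le hL
  rw [Finset.sum_range_add]
  simp only [Finset.sum_range_succ, Finset.sum_range_zero]
  rw [Finset.sum_eq_zero]
  · simp [wts]
  · intro k _
    rw [show 3 + k = k + 3 by ring]; rfl

open Classical in
/-- the environment -/
def roadEnv (a b : ℝ) (L : ℕ) (γ : Bool → ℕ → Vtx d) (W : Bool → ℕ → ℕ) : Sym2 (Vtx d) → ℝ :=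
  fun e => if h : ∃ q : Bool × ℕ, q.2 < L ∧ e = roadEdge γ q.1 q.2 then
    a + (b - a) * (W h.choose.1 h.choose.2 : ℝ) else b

lemma TwoRoads.roadEnv_spec (R : TwoRoads d n a b w L γ H) (ha : 0 < a) (W : Bool → ℕ → ℕ) :
    RoadEnv a b L γ W (roadEnv a b L γ W) := by
  constructor
  · intro i k hk
    unfold roadEnv
    have h : ∃ q : Bool × ℕ, q.2 < L ∧ roadEdge γ i k = roadEdge γ q.1 q.2 := ⟨(i, k), hk, rfl⟩
    rw [dif_pos h]
    obtain ⟨h1, h2⟩ := h.choose_spec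
    generalize h.choose = q at h1 h2
    obtain ⟨rfl, rfl⟩ := R.edge_inj ha hk h1 h2
    rfl
  · intro e he
    unfold roadEnv
    rw [dif_neg]
    rintro ⟨q, h1, h2⟩
    exact he _ _ h1 h2

/-- Updating the environment at a road edge. -/
lemma TwoRoads.update_env (R : TwoRoads d n a b w L γ H) (ha : 0 < a) {W W' : Bool → ℕ → ℕ}
    {ω : Sym2 (Vtx d) → ℝ} [DecidableEq (Sym2 (Vtx d))]
    (hω : RoadEnv a b L γ W ω) (i : Bool) (k : ℕ) (hk : k < L) (t : ℝ)
    (ht : t = a + (b - a) * (W' i k : ℝ)) (hW : ∀ j l, (j ≠ i ∨ l ≠ k) → W' j l = W j l) :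
    RoadEnv a b L γ W' (Function.update ω (roadEdge γ i k) t) := by
  constructor
  · intro j l hl
    rw [Function.update_apply]
    split_ifs with h
    · obtain ⟨rfl, rfl⟩ := R.edge_inj ha hl hk h
      exact ht
    · rw [hω.1 j l hl, hW j l]
      by_contra hcon
      push Not at hcon
      obtain ⟨rfl, rfl⟩ := hcon
      exact h rfl
  · intro e he
    rw [Function.update_of_ne (he i k hk)]
    exact hω.2 e he

lemma envDeriv_comm {E : Type*} [DecidableEq E] (a b : ℝ) (i j : E) (φ : (E → ℝ) → ℝ) :
    envDeriv a b i (envDeriv a b j φ) = envDeriv a b j (envDeriv a b i φ) := by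
  by_cases h : i = j
  · rw [h]
  · funext ω
    simp only [envDeriv, Function.update_comm h]
    ring

lemma envDerivOn_four {E : Type*} [DecidableEq E] (a b : ℝ) (e0 e1 e2 e3 : E)
    (hn : [e0, e1, e2, e3].Nodup) (φ : (E → ℝ) → ℝ) :
    envDerivOn a b [e0, e1, e2, e3].toFinset φ =
      envDeriv a b e0 (envDeriv a b e1 (envDeriv a b e2 (envDeriv a b e3 φ))) := by
  unfold envDerivOn
  rw [List.Perm.foldr_eq' (List.toFinset_toList hn)
    (fun x _ y _ z => envDeriv_comm a b y x z)]
  rfl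

lemma TwoRoads.nodup_U (R : TwoRoads d n a b w L γ H) (ha : 0 < a) :
    [roadEdge γ true 0, roadEdge γ true 1, roadEdge γ false 0, roadEdge γ false 1].Nodup := by
  have hL := R.hL
  have key : ∀ i j k l, k < L → l < L → (i ≠ j ∨ k ≠ l) → roadEdge γ i k ≠ roadEdge γ j l := by
    intro i j k l hk hl h he
    have := R.edge_inj ha hk hl he
    tauto
  simp only [List.nodup_cons, List.mem_cons, List.not_mem_nil, or_false, not_or,
    not_false_eq_true, List.nodup_nil, and_true]
  refine ⟨⟨?_, ?_, ?_⟩, ⟨?_, ?_⟩, ?_⟩ <;>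
    exact key _ _ _ _ (by omega) (by omega) (by simp)

lemma TwoRoads.nodup_L (R : TwoRoads d n a b w L γ H) (ha : 0 < a) :
    [roadEdge γ true 0, roadEdge γ true 1, roadEdge γ true 2, roadEdge γ false 0].Nodup := by
  have hL := R.hL
  have key : ∀ i j k l, k < L → l < L → (i ≠ j ∨ k ≠ l) → roadEdge γ i k ≠ roadEdge γ j l := by
    intro i j k l hk hl h he
    have := R.edge_inj ha hk hl he
    tauto
  simp only [List.nodup_cons, List.mem_cons, List.not_mem_nil, or_false, not_or,
    not_false_eq_true, List.nodup_nil, and_true]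
  refine ⟨⟨?_, ?_, ?_⟩, ⟨?_, ?_⟩, ?_⟩ <;>
    exact key _ _ _ _ (by omega) (by omega) (by simp)

lemma wts_le {x0 x1 x2 y0 y1 : ℕ} (h0 : x0 ≤ 1) (h1 : x1 ≤ 1) (h2 : x2 ≤ 1) (h3 : y0 ≤ 1)
    (h4 : y1 ≤ 1) (i : Bool) (k : ℕ) : wts x0 x1 x2 y0 y1 i k ≤ 1 := by
  unfold wts
  split <;> omega

/-- the value `a` or `b` -/
def ab (a b : ℝ) (x : ℕ) : ℝ := a + (b - a) * (x : ℝ)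

lemma TwoRoads.conclude {v : Vtx d} (R : TwoRoads d n a b (fun i => (n : ℤ) * v i) L γ H)
    (ha : 0 < a) (hab : a < b) :
    (∃ (n : ℕ) (S : Finset (Sym2 (Vtx d))) (ω : Sym2 (Vtx d) → ℝ),
       ↑S ⊆ EdgeSet d n ∧ S.card = 4 ∧ ValidEnv d n a b ω ∧
       envDerivOn a b S (fppT d v n) ω = 2 * (b - a)) ∧
    (∃ (n : ℕ) (S : Finset (Sym2 (Vtx d))) (ω : Sym2 (Vtx d) → ℝ),
       ↑S ⊆ EdgeSet d n ∧ S.card = 4 ∧ ValidEnv d n a b ω ∧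
       envDerivOn a b S (fppT d v n) ω = -(2 * (b - a))) := by
  have hL := R.hL
  have eb : b = ab a b 1 := by simp [ab]
  have ea : a = ab a b 0 := by simp [ab]
  constructor
  · refine ⟨n, [roadEdge γ true 0, roadEdge γ true 1, roadEdge γ false 0,
      roadEdge γ false 1].toFinset, roadEnv a b L γ (wts 0 0 0 0 0), ?_, ?_, ?_, ?_⟩
    · intro e he
      simp only [List.coe_toFinset, List.mem_cons, List.not_mem_nil, or_false,
        Set.mem_ofPred_eq] at he
      rcases he with rfl | rfl | rfl | rfl <;> exact R.road_mem _ _ (by omega)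
    · rw [List.toFinset_card_of_nodup (R.nodup_U ha)]; rfl
    · exact (R.roadEnv_spec ha _).valid (wts_le (by simp) (by simp) (by simp) (by simp) (by simp))
    · rw [envDerivOn_four a b _ _ _ _ (R.nodup_U ha)]
      have key : ∀ x0 x1 y0 y1 : ℕ, x0 ≤ 1 → x1 ≤ 1 → y0 ≤ 1 → y1 ≤ 1 →
          fppT d v n (Function.update (Function.update (Function.update (Function.update
            (roadEnv a b L γ (wts 0 0 0 0 0)) (roadEdge γ true 0) (ab a b x0))
            (roadEdge γ true 1) (ab a b x1)) (roadEdge γ false 0) (ab a b y0))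
            (roadEdge γ false 1) (ab a b y1)) =
          a * (L : ℝ) + (b - a) * ((min (x0 + x1 + 0) (y0 + y1) : ℕ) : ℝ) := by
        intro x0 x1 y0 y1 h0 h1 h2 h3
        refine R.time ha hab (wts x0 x1 0 y0 y1) (wts_le h0 h1 (by simp) h2 h3) _ _
          (wts_sum_true _ _ _ _ _ hL) (wts_sum_false _ _ _ _ _ hL) (by omega) ?_
        refine R.update_env ha (W := wts x0 x1 0 y0 0) ?_ _ _ (by omega) _ rfl ?_
        refine R.update_env ha (W := wts x0 x1 0 0 0) ?_ _ _ (by omega) _ rfl ?_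
        refine R.update_env ha (W := wts x0 0 0 0 0) ?_ _ _ (by omega) _ rfl ?_
        refine R.update_env ha (W := wts 0 0 0 0 0) (R.roadEnv_spec ha _) _ _ (by omega) _ rfl ?_
        all_goals
          intro j l hjl
          rcases j with _ | _ <;> rcases l with _ | _ | _ | l <;> simp [wts] at hjl ⊢
      simp only [envDeriv]
      have key' : ∀ x0 x1 y0 y1 : ℕ, x0 ≤ 1 → x1 ≤ 1 → y0 ≤ 1 → y1 ≤ 1 → ∀ s0 s1 t0 t1 : ℝ,
          s0 = ab a b x0 → s1 = ab a b x1 → t0 = ab a b y0 → t1 = ab a b y1 →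
          fppT d v n (Function.update (Function.update (Function.update (Function.update
            (roadEnv a b L γ (wts 0 0 0 0 0)) (roadEdge γ true 0) s0)
            (roadEdge γ true 1) s1) (roadEdge γ false 0) t0)
            (roadEdge γ false 1) t1) =
          a * (L : ℝ) + (b - a) * ((min (x0 + x1 + 0) (y0 + y1) : ℕ) : ℝ) := by
        intro x0 x1 y0 y1 h0 h1 h2 h3 s0 s1 t0 t1 e0 e1 e2 e3
        rw [e0, e1, e2, e3]; exact key x0 x1 y0 y1 h0 h1 h2 h3
      rw [key' 1 1 1 1 (by simp) (by simp) (by simp) (by simp) b b b b eb eb eb eb,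
        key' 1 1 1 0 (by simp) (by simp) (by simp) (by simp) b b b a eb eb eb ea,
        key' 1 1 0 1 (by simp) (by simp) (by simp) (by simp) b b a b eb eb ea eb,
        key' 1 1 0 0 (by simp) (by simp) (by simp) (by simp) b b a a eb eb ea ea,
        key' 1 0 1 1 (by simp) (by simp) (by simp) (by simp) b a b b eb ea eb eb,
        key' 1 0 1 0 (by simp) (by simp) (by simp) (by simp) b a b a eb ea eb ea,
        key' 1 0 0 1 (by simp) (by simp) (by simp) (by simp) b a a b eb ea ea eb,
        key' 1 0 0 0 (by simp) (by simp) (by simp) (by simp) b a a a eb ea ea ea,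
        key' 0 1 1 1 (by simp) (by simp) (by simp) (by simp) a b b b ea eb eb eb,
        key' 0 1 1 0 (by simp) (by simp) (by simp) (by simp) a b b a ea eb eb ea,
        key' 0 1 0 1 (by simp) (by simp) (by simp) (by simp) a b a b ea eb ea eb,
        key' 0 1 0 0 (by simp) (by simp) (by simp) (by simp) a b a a ea eb ea ea,
        key' 0 0 1 1 (by simp) (by simp) (by simp) (by simp) a a b b ea ea eb eb,
        key' 0 0 1 0 (by simp) (by simp) (by simp) (by simp) a a b a ea ea eb ea,
        key' 0 0 0 1 (by simp) (by simp) (by simp) (by simp) a a a b ea ea ea eb,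
        key' 0 0 0 0 (by simp) (by simp) (by simp) (by simp) a a a a ea ea ea ea]
      norm_num
      ring
  · refine ⟨n, [roadEdge γ true 0, roadEdge γ true 1, roadEdge γ true 2,
      roadEdge γ false 0].toFinset, roadEnv a b L γ (wts 0 0 0 0 1), ?_, ?_, ?_, ?_⟩
    · intro e he
      simp only [List.coe_toFinset, List.mem_cons, List.not_mem_nil, or_false,
        Set.mem_ofPred_eq] at he
      rcases he with rfl | rfl | rfl | rfl <;> exact R.road_mem _ _ (by omega)
    · rw [List.toFinset_card_of_nodup (R.nodup_L ha)]; rfl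
    · exact (R.roadEnv_spec ha _).valid (wts_le (by simp) (by simp) (by simp) (by simp) (by simp))
    · rw [envDerivOn_four a b _ _ _ _ (R.nodup_L ha)]
      have key' : ∀ x0 x1 x2 y0 : ℕ, x0 ≤ 1 → x1 ≤ 1 → x2 ≤ 1 → y0 ≤ 1 → ∀ s0 s1 s2 t0 : ℝ,
          s0 = ab a b x0 → s1 = ab a b x1 → s2 = ab a b x2 → t0 = ab a b y0 →
          fppT d v n (Function.update (Function.update (Function.update (Function.update
            (roadEnv a b L γ (wts 0 0 0 0 1)) (roadEdge γ true 0) s0)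
            (roadEdge γ true 1) s1) (roadEdge γ true 2) s2)
            (roadEdge γ false 0) t0) =
          a * (L : ℝ) + (b - a) * ((min (x0 + x1 + x2) (y0 + 1) : ℕ) : ℝ) := by
        intro x0 x1 x2 y0 h0 h1 h2 h3 s0 s1 s2 t0 e0 e1 e2 e3
        rw [e0, e1, e2, e3]
        refine R.time ha hab (wts x0 x1 x2 y0 1) (wts_le h0 h1 h2 h3 le_rfl) _ _
          (wts_sum_true _ _ _ _ _ hL) (wts_sum_false _ _ _ _ _ hL) (by omega) ?_
        refine R.update_env ha (W := wts x0 x1 x2 0 1) ?_ _ _ (by omega) _ rfl ?_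
        refine R.update_env ha (W := wts x0 x1 0 0 1) ?_ _ _ (by omega) _ rfl ?_
        refine R.update_env ha (W := wts x0 0 0 0 1) ?_ _ _ (by omega) _ rfl ?_
        refine R.update_env ha (W := wts 0 0 0 0 1) (R.roadEnv_spec ha _) _ _ (by omega) _ rfl ?_
        all_goals
          intro j l hjl
          rcases j with _ | _ <;> rcases l with _ | _ | _ | l <;> simp [wts] at hjl ⊢
      simp only [envDeriv]
      rw [key' 1 1 1 1 (by simp) (by simp) (by simp) (by simp) b b b b eb eb eb eb,
        key' 1 1 1 0 (by simp) (by simp) (by simp) (by simp) b b b a eb eb eb ea,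
        key' 1 1 0 1 (by simp) (by simp) (by simp) (by simp) b b a b eb eb ea eb,
        key' 1 1 0 0 (by simp) (by simp) (by simp) (by simp) b b a a eb eb ea ea,
        key' 1 0 1 1 (by simp) (by simp) (by simp) (by simp) b a b b eb ea eb eb,
        key' 1 0 1 0 (by simp) (by simp) (by simp) (by simp) b a b a eb ea eb ea,
        key' 1 0 0 1 (by simp) (by simp) (by simp) (by simp) b a a b eb ea ea eb,
        key' 1 0 0 0 (by simp) (by simp) (by simp) (by simp) b a a a eb ea ea ea,
        key' 0 1 1 1 (by simp) (by simp) (by simp) (by simp) a b b b ea eb eb eb,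
        key' 0 1 1 0 (by simp) (by simp) (by simp) (by simp) a b b a ea eb eb ea,
        key' 0 1 0 1 (by simp) (by simp) (by simp) (by simp) a b a b ea eb ea eb,
        key' 0 1 0 0 (by simp) (by simp) (by simp) (by simp) a b a a ea eb ea ea,
        key' 0 0 1 1 (by simp) (by simp) (by simp) (by simp) a a b b ea ea eb eb,
        key' 0 0 1 0 (by simp) (by simp) (by simp) (by simp) a a b a ea ea eb ea,
        key' 0 0 0 1 (by simp) (by simp) (by simp) (by simp) a a a b ea ea ea eb,
        key' 0 0 0 0 (by simp) (by simp) (by simp) (by simp) a a a a ea ea ea ea]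
      norm_num
      ring

end CyclePart

/-! ### Construction of the two roads -/

section RoadsPart

variable {d : ℕ}

lemma adjV_elim {x y : Vtx d} (h : adjV x y) :
    ∃ i, (x i - y i = 1 ∨ x i - y i = -1) ∧ ∀ j, j ≠ i → x j = y j := by
  unfold adjV at h
  have hex : ∃ i, |x i - y i| ≠ 0 := by
    by_contra hcon
    push Not at hcon
    rw [Finset.sum_eq_zero (fun i _ => hcon i)] at h
    exact absurd h (by norm_num)
  obtain ⟨i, hi⟩ := hex
  have h1 := Finset.add_sum_erase Finset.univ (fun i => |x i - y i|) (Finset.mem_univ i)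
  have h2 : 0 ≤ ∑ j ∈ Finset.univ.erase i, |x j - y j| :=
    Finset.sum_nonneg (fun j _ => abs_nonneg _)
  have h3 : 0 ≤ |x i - y i| := abs_nonneg _
  have h4 : ∑ j ∈ Finset.univ.erase i, |x j - y j| = 0 := by omega
  have h5 : |x i - y i| = 1 := by omega
  refine ⟨i, ?_, ?_⟩
  · rcases abs_choice (x i - y i) with h | h <;> omega
  · intro j hj
    have := (Finset.sum_eq_zero_iff_of_nonneg (fun j _ => abs_nonneg (x j - y j))).1 h4 j
      (Finset.mem_erase.2 ⟨hj, Finset.mem_univ _⟩)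
    have := abs_eq_zero.1 this
    omega

lemma adjV_intro {x y : Vtx d} (i : Fin d) (h : x i - y i = 1 ∨ x i - y i = -1)
    (h' : ∀ j, j ≠ i → x j = y j) : adjV x y := by
  unfold adjV
  rw [Finset.sum_eq_single i]
  · rcases h with h | h <;> rw [h] <;> simp
  · intro j _ hj
    rw [h' j hj]; simp
  · intro h; exact absurd (Finset.mem_univ i) h

lemma adjV_irrefl (x : Vtx d) : ¬ adjV x x := by
  intro h
  unfold adjV at h
  simp at h

/-- the transverse functional -/
def yFun (u x : Vtx d) : ℤ := ∑ j, (u j).sign * x j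

lemma adj_lin {x y u : Vtx d} {i : Fin d} {s : ℤ} (hs : s = 1 ∨ s = -1) (hu : u i = 0)
    (h : adjV x y) :
    (s * x i - s * y i) + (yFun u x - yFun u y) ≤ 1 ∧
    (s * x i - s * y i) - (yFun u x - yFun u y) ≤ 1 ∧
    -(s * x i - s * y i) + (yFun u x - yFun u y) ≤ 1 ∧
    -(s * x i - s * y i) - (yFun u x - yFun u y) ≤ 1 := by
  obtain ⟨i', h1, h2⟩ := adjV_elim h
  have hY : yFun u x - yFun u y = (u i').sign * (x i' - y i') := by
    unfold yFun
    rw [← Finset.sum_sub_distrib, Finset.sum_eq_single i']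
    · ring
    · intro j _ hj
      rw [h2 j hj]; ring
    · intro h; exact absurd (Finset.mem_univ i') h
  rw [hY, ← mul_sub]
  by_cases hi : i = i'
  · subst hi
    rw [hu]
    rcases hs with rfl | rfl <;> rcases h1 with h1 | h1 <;> rw [h1] <;> simp
  · rw [h2 i hi]
    rcases lt_trichotomy (u i') 0 with h | h | h
    · rw [Int.sign_eq_neg_one_of_neg h]
      rcases h1 with h1 | h1 <;> rw [h1] <;> simp
    · rw [h]; simp
    · rw [Int.sign_eq_one_of_pos h]
      rcases h1 with h1 | h1 <;> rw [h1] <;> simp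

lemma sign_cases {z : ℤ} (hz : z ≠ 0) : z.sign = 1 ∨ z.sign = -1 := by
  rcases lt_or_gt_of_ne hz with h | h
  · right; exact Int.sign_eq_neg_one_of_neg h
  · left; exact Int.sign_eq_one_of_pos h

lemma exists_roads_two {a b : ℝ} (ha : 0 < a) (v : Vtx d) (hv : ∀ i, |v i| ≤ 2)
    {i j : Fin d} (hij : j ≠ i) (hi : v i ≠ 0) (hj : v j ≠ 0) :
    ∃ (n L : ℕ) (γ : Bool → ℕ → Vtx d) (H : Vtx d → ℝ),
      TwoRoads d n a b (fun k => (n : ℤ) * v k) L γ H := by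
  set w : Vtx d := fun k => ((2 : ℕ) : ℤ) * v k with hw
  set u : Vtx d := Function.update w i 0 with hu
  obtain ⟨s, hsdef⟩ : ∃ s, s = (v i).sign := ⟨_, rfl⟩
  have hs : s = 1 ∨ s = -1 := by rw [hsdef]; exact sign_cases hi
  obtain ⟨p, hp⟩ : ∃ p : ℕ, (p : ℤ) = |w i| := ⟨(w i).natAbs, by simp⟩
  have hsp : s * (p : ℤ) = w i := by
    rw [hp, hw, hsdef]
    simp only [abs_mul]
    rw [mul_left_comm, Int.sign_mul_abs]; simp
  obtain ⟨q, hq⟩ : ∃ q : ℕ, (q : ℤ) = ∑ j, |u j| :=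
    ⟨(∑ j, |u j|).toNat, Int.toNat_of_nonneg (Finset.sum_nonneg (fun j _ => abs_nonneg _))⟩
  have hui : u i = 0 := by simp [hu]
  have huj : ∀ k, k ≠ i → u k = w k := fun k hk => by simp [hu, hk]
  have abs2 : ∀ z : ℤ, z ≠ 0 → 2 ≤ |((2 : ℕ) : ℤ) * z| := by
    intro z hz
    rw [abs_mul]
    have := Int.one_le_abs hz
    simp; omega
  have hp2 : 2 ≤ p := by
    have := abs2 _ hi
    rw [hw] at hp
    dsimp only at hp
    omega
  have hq2 : 2 ≤ q := by
    have h1 := abs2 _ hj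
    have h2 : |u j| ≤ ∑ j, |u j| :=
      Finset.single_le_sum (f := fun j => |u j|) (fun j _ => abs_nonneg _) (Finset.mem_univ j)
    rw [huj j hij, hw] at h2
    dsimp only at h2
    omega
  obtain ⟨Q, hQ0, hQq, hQadj, hQbd, hQy⟩ := mono_path q u hq.symm
  have hQi : ∀ k ≤ q, Q k i = 0 := by
    intro k hk
    have := hQbd k hk i
    rw [hui] at this
    simpa using this
  let P : ℕ → ℕ → Vtx d := fun m l => Function.update (Q l) i (s * (m : ℤ))
  have hss : s * s = 1 := by rcases hs with h | h <;> rw [h] <;> norm_num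
  have hPX : ∀ m l, s * P m l i = m := by
    intro m l
    simp only [P, Function.update_self]
    rw [← mul_assoc, hss, one_mul]
  have hPY : ∀ m l, l ≤ q → yFun u (P m l) = l := by
    intro m l hl
    rw [← hQy l hl]
    unfold yFun
    refine Finset.sum_congr rfl (fun k _ => ?_)
    by_cases hk : k = i
    · subst hk; rw [hui]; simp
    · simp [P, hk]
  have hPadj : ∀ m l m' l', l ≤ q → l' ≤ q → adjV (P m l) (P m' l') →
      (m : ℤ) - m' + (l - l') ≤ 1 ∧ (m : ℤ) - m' - (l - l') ≤ 1 ∧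
      -((m : ℤ) - m') + (l - l') ≤ 1 ∧ -((m : ℤ) - m') - (l - l') ≤ 1 := by
    intro m l m' l' hl hl' h
    have := adj_lin hs hui h
    rwa [hPX, hPX, hPY _ _ hl, hPY _ _ hl'] at this
  have hPirr : ∀ m l m' l', adjV (P m l) (P m' l') → ¬ (m = m' ∧ l = l') := by
    rintro m l m' l' h ⟨rfl, rfl⟩
    exact adjV_irrefl _ h
  have hstepX : ∀ m l, adjV (P m l) (P (m + 1) l) := by
    intro m l
    refine adjV_intro i ?_ ?_
    · simp only [P, Function.update_self]
      push_cast
      rcases hs with h | h <;> rw [h]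
      · right; ring
      · left; ring
    · intro k hk
      simp [P, hk]
  have hstepY : ∀ m l, l < q → adjV (P m l) (P m (l + 1)) := by
    intro m l hl
    have h := hQadj l hl
    unfold adjV at h ⊢
    rw [← h]
    refine Finset.sum_congr rfl (fun k _ => ?_)
    by_cases hk : k = i
    · subst hk
      rw [hQi l hl.le, hQi (l + 1) hl]; simp [P]
    · simp [P, hk]
  have hP0 : P 0 0 = 0 := by
    funext k
    by_cases hk : k = i
    · subst hk; simp [P]
    · simp [P, hk, hQ0]
  have hPw : P p q = w := by
    funext k
    by_cases hk : k = i
    · subst hk; simp [P, hsp]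
    · simp [P, hk, hQq, huj k hk]
  have hPbox : ∀ m l, m ≤ p → l ≤ q → inBox 2 (P m l) := by
    intro m l hm hl k
    have hwk : |w k| ≤ 4 := by
      rw [hw]; dsimp only
      rw [abs_mul]
      have := hv k
      simp; omega
    by_cases hk : k = i
    · subst hk
      simp only [P, Function.update_self]
      have : |s * (m : ℤ)| = m := by
        rcases hs with h | h <;> rw [h] <;> simp
      rw [this]
      push_cast
      omega
    · simp only [P, Function.update_of_ne hk]
      have := hQbd l hl k
      rw [huj k hk] at this
      push_cast
      omega
  let γ : Bool → ℕ → Vtx d := fun t k => if t then P (min k p) (k - p) else P (k - q) (min k q)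
  have γt : ∀ k, γ true k = P (min k p) (k - p) := fun k => rfl
  have γf : ∀ k, γ false k = P (k - q) (min k q) := fun k => rfl
  refine ⟨2, p + q, γ, fun x => a * ((s * x i + yFun u x : ℤ) : ℝ), ?_⟩
  refine ⟨by omega, ?_, ?_, ?_, ?_, ?_, ?_, ?_, ?_⟩
  · rintro (_ | _)
    · rw [γf, Nat.zero_sub, Nat.zero_min, hP0]
    · rw [γt, Nat.zero_sub, Nat.zero_min, hP0]
  · rintro (_ | _)
    · rw [γf, show p + q - q = p by omega, show min (p + q) q = q by omega, hPw]
    · rw [γt, show p + q - p = q by omega, show min (p + q) p = p by omega, hPw]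
  · rintro (_ | _) k hk
    · rw [γf, γf]
      rcases lt_or_ge k q with h | h
      · rw [show k + 1 - q = 0 by omega, show k - q = 0 by omega, show min k q = k by omega,
          show min (k + 1) q = k + 1 by omega]
        exact hstepY _ _ h
      · rw [show k + 1 - q = (k - q) + 1 by omega, show min k q = q by omega,
          show min (k + 1) q = q by omega]
        exact hstepX _ _
    · rw [γt, γt]
      rcases lt_or_ge k p with h | h
      · rw [show k + 1 - p = 0 by omega, show k - p = 0 by omega, show min k p = k by omega,
          show min (k + 1) p = k + 1 by omega]
        exact hstepX _ _
      · rw [show k + 1 - p = (k - p) + 1 by omega, show min k p = p by omega,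
          show min (k + 1) p = p by omega]
        exact hstepY _ _ (by omega)
  · rintro (_ | _) k hk
    · exact hPbox _ _ (by omega) (by omega)
    · exact hPbox _ _ (by omega) (by omega)
  · rintro (_ | _) k hk
    · rw [γf, hPX, hPY _ _ (by omega), show (((k - q : ℕ) : ℤ) + ((min k q : ℕ) : ℤ)) = k by omega]
      simp
    · rw [γt, hPX, hPY _ _ (by omega), show (((min k p : ℕ) : ℤ) + ((k - p : ℕ) : ℤ)) = k by omega]
      simp
  · have key : ∀ k ≤ p + q, γ true k = γ false k → k = 0 ∨ k = p + q := by
      intro k hk h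
      rw [γt, γf] at h
      have h1 := hPX (min k p) (k - p)
      have h2 := hPY (min k p) (k - p) (by omega)
      rw [h, hPX] at h1
      rw [h, hPY _ _ (by omega)] at h2
      omega
    rintro (_ | _) (_ | _) k hk h
    · left; rfl
    · right; exact key k hk h.symm
    · right; exact key k hk h
    · left; rfl
  · rintro (_ | _) (_ | _) k l hkl hl h
    · rw [γf, γf] at h
      have h1 := hPadj _ _ _ _ (by omega) (by omega) h
      have h2 := hPirr _ _ _ _ h
      refine ⟨by omega, Or.inl rfl⟩
    · rw [γf, γt] at h
      have h1 := hPadj _ _ _ _ (by omega) (by omega) h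
      have h2 := hPirr _ _ _ _ h
      have h3 : l = k + 1 := by omega
      refine ⟨h3, Or.inr ?_⟩
      omega
    · rw [γf, γt] at h
      have h1 := hPadj _ _ _ _ (by omega) (by omega) h
      have h2 := hPirr _ _ _ _ h
      have h3 : l = k + 1 := by omega
      refine ⟨h3, Or.inr ?_⟩
      omega
    · rw [γt, γt] at h
      have h1 := hPadj _ _ _ _ (by omega) (by omega) h
      have h2 := hPirr _ _ _ _ h
      refine ⟨by omega, Or.inl rfl⟩
  · intro x y h
    left
    have h1 := adj_lin hs hui h
    rw [← mul_sub, ← Int.cast_sub, abs_mul, abs_of_pos ha]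
    have h2 : |(((s * x i + yFun u x) - (s * y i + yFun u y) : ℤ) : ℝ)| ≤ 1 := by
      rw [← Int.cast_abs]
      have : |(s * x i + yFun u x) - (s * y i + yFun u y)| ≤ 1 := by
        rw [abs_le]; omega
      exact_mod_cast this
    nlinarith

/-- height function when the target lies on an axis -/
def axisH (a δ : ℝ) (m X R : ℤ) : ℝ :=
  if R = 0 then
    (if X = 0 then 0 else if X = m then a * ((m : ℝ) + 2) else
      if 0 < X ∧ X < m then a * (X : ℝ) + min (((X : ℝ) - 1) * δ) (2 * a) else a * ((X : ℝ) + 1))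
  else a * ((X : ℝ) + 1)

lemma axisH_trans {a δ : ℝ} (ha : 0 < a) (hδ : 0 < δ) (m X R R' : ℤ) :
    |axisH a δ m X R - axisH a δ m X R'| ≤ a := by
  have key : |axisH a δ m X 0 - a * ((X : ℝ) + 1)| ≤ a := by
    unfold axisH
    rw [if_pos rfl]
    split_ifs with h1 h2 h3
    · rw [h1]; simp [abs_of_pos ha]
    · rw [h2, abs_le]; constructor <;> nlinarith
    · have h4 : (1 : ℝ) ≤ (X : ℝ) := by exact_mod_cast (show 1 ≤ X by omega)
      have h5 : 0 ≤ min (((X : ℝ) - 1) * δ) (2 * a) :=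
        le_min (mul_nonneg (by linarith) hδ.le) (by linarith)
      have h6 := min_le_right (((X : ℝ) - 1) * δ) (2 * a)
      rw [abs_le]; constructor <;> linarith
    · simp [ha.le]
  have pos : ∀ R : ℤ, R ≠ 0 → axisH a δ m X R = a * ((X : ℝ) + 1) := by
    intro R h
    unfold axisH; rw [if_neg h]
  by_cases h : R = 0 <;> by_cases h' : R' = 0
  · rw [h, h']; simp [ha.le]
  · rw [h, pos R' h']; exact key
  · rw [h', pos R h, abs_sub_comm]; exact key
  · rw [pos R h, pos R' h']; simp [ha.le]

lemma axisH_long {a δ : ℝ} (ha : 0 < a) (hδ : 0 < δ) (m X R : ℤ) (hm : 2 ≤ m)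
    (hm2 : 2 * a ≤ ((m : ℝ) - 2) * δ) :
    |axisH a δ m (X + 1) R - axisH a δ m X R| ≤ a ∨
    (|axisH a δ m (X + 1) R - axisH a δ m X R| ≤ a + δ ∧ R = 0 ∧ 0 < X ∧ X + 1 < m) := by
  by_cases hR : R = 0
  · subst hR
    by_cases hX : 0 < X ∧ X + 1 < m
    · right
      refine ⟨?_, rfl, hX⟩
      unfold axisH
      rw [if_pos rfl, if_pos rfl, if_neg (by omega), if_neg (by omega), if_pos (by omega),
        if_neg (by omega), if_neg (by omega), if_pos (by omega)]
      push_cast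
      have e1 : min (((X : ℝ) - 1) * δ) (2 * a) ≤ min (((X : ℝ) + 1 - 1) * δ) (2 * a) :=
        min_le_min (by nlinarith) le_rfl
      have e2 : min (((X : ℝ) + 1 - 1) * δ) (2 * a) ≤ min (((X : ℝ) - 1) * δ) (2 * a) + δ := by
        rw [← min_add_add_right]
        exact min_le_min (by linarith) (by linarith)
      rw [abs_le]; constructor <;> linarith
    · left
      rcases lt_trichotomy X 0 with h | h | h
      · by_cases h1 : X = -1
        · subst h1
          unfold axisH
          rw [if_pos rfl, if_pos rfl, if_pos (by norm_num), if_neg (by norm_num),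
            if_neg (by omega), if_neg (by omega)]
          simp [ha.le]
        · unfold axisH
          rw [if_pos rfl, if_pos rfl, if_neg (by omega), if_neg (by omega), if_neg (by omega),
            if_neg (by omega), if_neg (by omega), if_neg (by omega)]
          push_cast
          rw [abs_le]; constructor <;> linarith
      · subst h
        unfold axisH
        rw [if_pos rfl, if_pos rfl, if_neg (by omega), if_neg (by omega), if_pos (by omega),
          if_pos rfl]
        simp [ha.le, abs_of_pos ha]
      · rcases lt_trichotomy X m with h2 | h2 | h2
        · obtain rfl : X = m - 1 := by omega
          unfold axisH
          rw [if_pos rfl, if_pos rfl, if_neg (by omega), if_pos (by omega), if_neg (by omega),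
            if_neg (by omega), if_pos (by omega)]
          push_cast
          rw [min_eq_right (by linarith)]
          rw [abs_le]; constructor <;> linarith
        · subst h2
          unfold axisH
          rw [if_pos rfl, if_pos rfl, if_neg (by omega), if_neg (by omega), if_neg (by omega),
            if_neg (by omega), if_pos rfl]
          push_cast
          rw [abs_le]; constructor <;> linarith
        · unfold axisH
          rw [if_pos rfl, if_pos rfl, if_neg (by omega), if_neg (by omega), if_neg (by omega),
            if_neg (by omega), if_neg (by omega), if_neg (by omega)]
          push_cast
          rw [abs_le]; constructor <;> linarith
  · left
    unfold axisH
    rw [if_neg hR, if_neg hR]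
    push_cast
    rw [abs_le]; constructor <;> linarith

lemma exists_roads_one {a b : ℝ} (ha : 0 < a) (hab : a < b) (v : Vtx d) (hv : ∀ i, |v i| ≤ 2)
    {i j : Fin d} (hij : j ≠ i) (hi : v i ≠ 0) (hz : ∀ k, k ≠ i → v k = 0) :
    ∃ (n L : ℕ) (γ : Bool → ℕ → Vtx d) (H : Vtx d → ℝ),
      TwoRoads d n a b (fun k => (n : ℤ) * v k) L γ H := by
  have hδ : 0 < b - a := by linarith
  obtain ⟨n0, hn0⟩ := Archimedean.arch (2 * a) hδ
  rw [nsmul_eq_mul] at hn0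
  obtain ⟨n, hn⟩ : ∃ n, n = n0 + 2 := ⟨_, rfl⟩
  obtain ⟨s, hsdef⟩ : ∃ s, s = (v i).sign := ⟨_, rfl⟩
  have hs : s = 1 ∨ s = -1 := by rw [hsdef]; exact sign_cases hi
  have hss : s * s = 1 := by rcases hs with h | h <;> rw [h] <;> norm_num
  obtain ⟨m, hm⟩ : ∃ m : ℕ, m = n * (v i).natAbs := ⟨_, rfl⟩
  have hmn : n ≤ m := by
    rw [hm]
    exact Nat.le_mul_of_pos_right n (Int.natAbs_pos.2 hi)
  have hm2n : m ≤ 2 * n := by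
    rw [hm, mul_comm]
    refine Nat.mul_le_mul_right n ?_
    have := abs_le.1 (hv i)
    omega
  have hm2 : 2 ≤ m := by omega
  have hmδ : 2 * a ≤ (((m : ℤ) : ℝ) - 2) * (b - a) := by
    refine hn0.trans (mul_le_mul_of_nonneg_right ?_ hδ.le)
    have : ((n0 + 2 : ℕ) : ℝ) ≤ (m : ℝ) := by exact_mod_cast (hn ▸ hmn)
    push_cast at this ⊢
    linarith
  have hsm : s * (m : ℤ) = (n : ℤ) * v i := by
    rw [hm, hsdef]
    push_cast
    rw [mul_left_comm, Int.sign_mul_abs]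
  -- points
  let P : ℤ → ℤ → Vtx d := fun x y => Function.update (Function.update 0 i (s * x)) j y
  have hPi : ∀ x y, P x y i = s * x := by
    intro x y; simp [P, Ne.symm hij]
  have hPj : ∀ x y, P x y j = y := by
    intro x y; simp [P]
  have hPk : ∀ x y k, k ≠ i → k ≠ j → P x y k = 0 := by
    intro x y k h1 h2; simp [P, h1, h2]
  have hPX : ∀ x y, s * P x y i = x := by
    intro x y; rw [hPi, ← mul_assoc, hss, one_mul]
  let R : Vtx d → ℤ := fun x => ∑ k ∈ Finset.univ.erase i, |x k|
  have hPR : ∀ x y, R (P x y) = |y| := by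
    intro x y
    simp only [R]
    rw [Finset.sum_eq_single j]
    · rw [hPj]
    · intro k hk hkj
      rw [hPk x y k (Finset.ne_of_mem_erase hk) hkj]; simp
    · intro h; exact absurd (Finset.mem_erase.2 ⟨hij, Finset.mem_univ _⟩) h
  have hPadj : ∀ x y x' y', adjV (P x y) (P x' y') →
      (x = x' ∧ (y - y' = 1 ∨ y - y' = -1)) ∨ ((x - x' = 1 ∨ x - x' = -1) ∧ y = y') := by
    intro x y x' y' h
    obtain ⟨k, h1, h2⟩ := adjV_elim h
    by_cases hki : k = i
    · subst hki
      right
      have h3 := h2 j hij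
      rw [hPj, hPj] at h3
      rw [hPi, hPi, ← mul_sub] at h1
      refine ⟨?_, h3⟩
      rcases hs with h | h <;> rw [h] at h1 <;> omega
    · left
      have h3 := h2 i (Ne.symm hki)
      have h4 := hPX x y
      rw [h3, hPX] at h4
      refine ⟨h4.symm, ?_⟩
      by_cases hkj : k = j
      · subst hkj
        rwa [hPj, hPj] at h1
      · rw [hPk _ _ _ hki hkj, hPk _ _ _ hki hkj] at h1
        omega
  have hadjX : ∀ x y, adjV (P x y) (P (x + 1) y) := by
    intro x y
    refine adjV_intro i ?_ ?_
    · rw [hPi, hPi]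
      rcases hs with h | h <;> rw [h]
      · right; ring
      · left; ring
    · intro k hk
      by_cases hkj : k = j
      · subst hkj; rw [hPj, hPj]
      · rw [hPk _ _ _ hk hkj, hPk _ _ _ hk hkj]
  have hadjY : ∀ x y y', (y - y' = 1 ∨ y - y' = -1) → adjV (P x y) (P x y') := by
    intro x y y' h
    refine adjV_intro j ?_ ?_
    · rwa [hPj, hPj]
    · intro k hk
      by_cases hki : k = i
      · subst hki; rw [hPi, hPi]
      · rw [hPk _ _ _ hki hk, hPk _ _ _ hki hk]
  have hP0 : P 0 0 = 0 := by
    funext k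
    by_cases hki : k = i
    · subst hki; rw [hPi]; simp
    · by_cases hkj : k = j
      · subst hkj; rw [hPj]; rfl
      · rw [hPk _ _ _ hki hkj]; rfl
  have hPw : P m 0 = fun k => (n : ℤ) * v k := by
    funext k
    by_cases hki : k = i
    · subst hki; rw [hPi, hsm]
    · rw [hz k hki, mul_zero]
      by_cases hkj : k = j
      · subst hkj; rw [hPj]
      · rw [hPk _ _ _ hki hkj]
  have hPbox : ∀ (x : ℕ) (y : ℤ), x ≤ m → |y| ≤ 1 → inBox n (P x y) := by
    intro x y hx hy k
    by_cases hki : k = i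
    · subst hki
      rw [hPi]
      have : |s * (x : ℤ)| = x := by
        rcases hs with h | h <;> rw [h] <;> simp
      rw [this]
      omega
    · by_cases hkj : k = j
      · subst hkj; rw [hPj]; omega
      · rw [hPk _ _ _ hki hkj]; simp
  -- roads
  let ep : Bool → ℤ := fun t => if t then 1 else -1
  have hep : ∀ t, ep t = 1 ∨ ep t = -1 := by
    rintro (_ | _)
    · right; rfl
    · left; rfl
  have hepinj : ∀ t t', ep t = ep t' → t = t' := by
    rintro (_ | _) (_ | _) h
    · rfl
    · exact absurd h (by simp [ep])
    · exact absurd h (by simp [ep])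
    · rfl
  let yy : Bool → ℕ → ℤ := fun t k => if k = 0 ∨ m + 2 ≤ k then 0 else ep t
  have hyy : ∀ t k, ((k = 0 ∨ m + 2 ≤ k) ∧ yy t k = 0) ∨ (1 ≤ k ∧ k ≤ m + 1 ∧ yy t k = ep t) := by
    intro t k
    by_cases h : k = 0 ∨ m + 2 ≤ k
    · left; exact ⟨h, if_pos h⟩
    · right; exact ⟨by omega, by omega, if_neg h⟩
  let γ : Bool → ℕ → Vtx d := fun t k => P ((min (k - 1) m : ℕ) : ℤ) (yy t k)
  have hγ : ∀ t k, γ t k = P ((min (k - 1) m : ℕ) : ℤ) (yy t k) := fun t k => rfl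
  have hoff : ∀ x : Vtx d, R x = 0 → 0 < s * x i → s * x i < m → ∀ t, ∀ k ≤ m + 2, γ t k ≠ x := by
    rintro x h1 h2 h3 t k hk rfl
    rw [hγ] at h1 h2 h3
    rw [hPR] at h1
    rw [hPX] at h2 h3
    have h4 := abs_eq_zero.1 h1
    rcases hyy t k with h | h
    · omega
    · rcases hep t with h' | h' <;> omega
  refine ⟨n, m + 2, γ, fun x => axisH a (b - a) m (s * x i) (R x), ?_⟩
  refine ⟨by omega, ?_, ?_, ?_, ?_, ?_, ?_, ?_, ?_⟩
  · intro t
    rw [hγ, show yy t 0 = 0 from if_pos (Or.inl rfl)]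
    simpa using hP0
  · intro t
    rw [hγ, show yy t (m + 2) = 0 from if_pos (Or.inr le_rfl), show min (m + 2 - 1) m = m by omega]
    exact hPw
  · intro t k hk
    rw [hγ, hγ]
    rcases hyy t k with ⟨h1, h2⟩ | ⟨h1, h1', h2⟩
    · rcases hyy t (k + 1) with ⟨h3, h4⟩ | ⟨h3, h3', h4⟩
      · omega
      · rw [h2, h4, show min (k + 1 - 1) m = min (k - 1) m by omega]
        apply hadjY
        rcases hep t with h' | h' <;> omega
    · rcases hyy t (k + 1) with ⟨h3, h4⟩ | ⟨h3, h3', h4⟩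
      · rw [h2, h4, show min (k + 1 - 1) m = min (k - 1) m by omega]
        apply hadjY
        rcases hep t with h' | h' <;> omega
      · rw [h2, h4, show ((min (k + 1 - 1) m : ℕ) : ℤ) = ((min (k - 1) m : ℕ) : ℤ) + 1 by omega]
        apply hadjX
  · intro t k hk
    rw [hγ]
    refine hPbox _ _ (by omega) ?_
    rcases hyy t k with h | h
    · rw [h.2]; simp
    · rw [h.2.2]
      rcases hep t with h' | h' <;> rw [h'] <;> simp
  · intro t k hk
    rw [hγ, hPX, hPR]
    rcases hyy t k with ⟨h1, h2⟩ | ⟨h1, h1', h2⟩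
    · rw [h2]
      unfold axisH
      rw [if_pos (by simp)]
      rcases h1 with h1 | h1
      · subst h1; simp
      · obtain rfl : k = m + 2 := by omega
        rw [show min (m + 2 - 1) m = m by omega, if_neg (by omega), if_pos rfl]
        push_cast; ring
    · rw [h2]
      unfold axisH
      rw [if_neg (by rcases hep t with h' | h' <;> rw [h'] <;> simp)]
      obtain ⟨k', rfl⟩ := Nat.exists_eq_add_of_le' h1
      rw [show min (k' + 1 - 1) m = k' by omega]
      push_cast; ring
  · intro t t' k hk h
    rw [hγ, hγ] at h
    have h1 := hPj ((min (k - 1) m : ℕ) : ℤ) (yy t k)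
    rw [h, hPj] at h1
    rcases hyy t k with h2 | h2
    · omega
    · rcases hyy t' k with h3 | h3
      · omega
      · left
        apply hepinj
        rw [← h2.2.2, ← h3.2.2, h1]
  · intro t t' k l hkl hl h
    rw [hγ, hγ] at h
    have h1 := hPadj _ _ _ _ h
    have e1 := hep t
    have e2 := hep t'
    have e3 := hepinj t t'
    rcases hyy t k with h2 | h2 <;> rcases hyy t' l with h3 | h3
    · omega
    · omega
    · omega
    · have h4 : ep t = ep t' := by omega
      have h5 := e3 h4
      exact ⟨by omega, Or.inl h5⟩
  · intro x y h
    obtain ⟨k, h1, h2⟩ := adjV_elim h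
    by_cases hk : k = i
    · subst hk
      have hR : R x = R y := by
        refine Finset.sum_congr rfl (fun l hl => ?_)
        rw [h2 l (Finset.ne_of_mem_erase hl)]
      have hX : s * x k = s * y k + 1 ∨ s * y k = s * x k + 1 := by
        rcases hs with h | h <;> rw [h] <;> omega
      rcases hX with hX | hX
      · rcases axisH_long ha hδ m (s * y k) (R y) (by omega) hmδ with h3 | ⟨h3, h4, h5, h6⟩
        · left; rw [hR, hX]; exact h3
        · right
          refine ⟨?_, hoff x (by omega) (by omega) (by omega), hoff y (by omega) (by omega)
            (by omega)⟩
          rw [hR, hX]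
          linarith
      · rcases axisH_long ha hδ m (s * x k) (R x) (by omega) hmδ with h3 | ⟨h3, h4, h5, h6⟩
        · left; rw [← hR, hX, abs_sub_comm]; exact h3
        · right
          refine ⟨?_, hoff x (by omega) (by omega) (by omega), hoff y (by omega) (by omega)
            (by omega)⟩
          rw [← hR, hX, abs_sub_comm]
          linarith
    · left
      rw [h2 i (Ne.symm hk)]
      exact axisH_trans ha hδ _ _ _ _

lemma exists_roads {a b : ℝ} (hd : 3 ≤ d) (ha : 0 < a) (hab : a < b) (v : Vtx d)
    (hv : ∀ i, |v i| ≤ 2) (hv0 : v ≠ 0) :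
    ∃ (n L : ℕ) (γ : Bool → ℕ → Vtx d) (H : Vtx d → ℝ),
      TwoRoads d n a b (fun k => (n : ℤ) * v k) L γ H := by
  obtain ⟨i, hi⟩ := Function.ne_iff.1 hv0
  by_cases h : ∃ j, j ≠ i ∧ v j ≠ 0
  · obtain ⟨j, hj, hj'⟩ := h
    exact exists_roads_two ha v hv hj hi hj'
  · push Not at h
    have : Nontrivial (Fin d) := Fin.nontrivial_iff_two_le.2 (by omega)
    obtain ⟨j, hj⟩ := exists_ne i
    exact exists_roads_one ha hab v hv hj hi h

end RoadsPart
/--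
In dimensions `d ≥ 3`, the fourth-order extremal values satisfy `U₄ = 2`
and `L₄ = −2`: for every `n`, every `S ⊆ W_n` with `|S| = 4`, and every `ω ∈ Ω_n` one has
`−2(b−a) ≤ ∂_S f_n(ω) ≤ 2(b−a)`; moreover there exist `n`, `S` with `|S| = 4`, and `ω`
with `∂_S f_n(ω) = 2(b−a)`, and there exist `n`, `S` with `|S| = 4`, and `ω` with
`∂_S f_n(ω) = −2(b−a)`.
-/
theorem extremal_fourth_deriv_values (d : ℕ) (hd : 3 ≤ d) (a b : ℝ) (ha : 0 < a)
    (hab : a < b) (v : Vtx d) (hv : ∀ i, |v i| ≤ 2) (hv0 : v ≠ 0) :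
    (∀ (n : ℕ) (S : Finset (Sym2 (Vtx d))), ↑S ⊆ EdgeSet d n → S.card = 4 →
      ∀ ω : Sym2 (Vtx d) → ℝ, ValidEnv d n a b ω →
        -(2 * (b - a)) ≤ envDerivOn a b S (fppT d v n) ω ∧
        envDerivOn a b S (fppT d v n) ω ≤ 2 * (b - a)) ∧
    (∃ (n : ℕ) (S : Finset (Sym2 (Vtx d))) (ω : Sym2 (Vtx d) → ℝ),
       ↑S ⊆ EdgeSet d n ∧ S.card = 4 ∧ ValidEnv d n a b ω ∧
       envDerivOn a b S (fppT d v n) ω = 2 * (b - a)) ∧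
    (∃ (n : ℕ) (S : Finset (Sym2 (Vtx d))) (ω : Sym2 (Vtx d) → ℝ),
       ↑S ⊆ EdgeSet d n ∧ S.card = 4 ∧ ValidEnv d n a b ω ∧
       envDerivOn a b S (fppT d v n) ω = -(2 * (b - a))) := by
  refine ⟨fun n S _ hc ω hω => fourth_bound ha hab (fun i => ?_) S hc ω hω, ?_⟩
  · rw [abs_mul, Nat.abs_cast]
    have h0 : (0 : ℤ) ≤ (n : ℤ) := Int.natCast_nonneg n
    nlinarith [hv i]
  · obtain ⟨n, L, γ, H, R⟩ := exists_roads hd ha hab v hv hv0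
    exact R.conclude ha hab

end
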